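/- arXiv:1805.11290 — 3 statements merged into one kernel-verified Lean document; each statement's English description precedes it below -/
import Mathlib

section
/- Let λ > 0 and, for each α ∈ 𝒜, let H_α : [0, ℓ_α] × ℝ → ℝ be continuous. Suppose v, u ∈ C²(Γ) satisfy: (i) −μ_α v_α''(y) + H_α(y, v_α'(y)) + λ v_α(y) ≥ −μ_α u_α''(y) + H_α(y, u_α'(y)) + λ u_α(y) for all y ∈ (0, ℓ_α) and all α ∈ 𝒜; and (ii) ∑_{α∈𝒜_i} γ_iα μ_α ∂_α v(ν_i) ≥ ∑_{α∈𝒜_i} γ_iα μ_α ∂_α u(ν_i) for every vertex ν_i, i ∈ I. Then v ≥ u on Γ, i.e. v_α(y) ≥ u_α(y) for every α ∈ 𝒜 and y ∈ [0, ℓ_α]. -/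
open Set

/-- A connected network: finite vertex set `I`, finite edge set `A`, each edge `α`
identified with `[0, ℓ α]`, with endpoint `0` attached to `src α` and endpoint `ℓ α`
attached to `tgt α`, these being distinct vertices; the resulting graph is connected. -/
structure Network (I A : Type) [Fintype I] [Fintype A] [DecidableEq I] where
  ℓ : A → ℝ
  ℓ_pos : ∀ α, 0 < ℓ α
  src : A → I
  tgt : A → I
  src_ne_tgt : ∀ α, src α ≠ tgt α
  connected : ∀ i j : I,
    Relation.ReflTransGen
      (fun i j => ∃ α, (src α = i ∧ tgt α = j) ∨ (src α = j ∧ tgt α = i)) i j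

namespace Network

variable {I A : Type} [Fintype I] [Fintype A] [DecidableEq I]

/-- The set `𝒜_i` of edges incident to the vertex `i`. -/
def edges (N : Network I A) (i : I) : Finset A :=
  Finset.univ.filter fun α => N.src α = i ∨ N.tgt α = i

/-- The value `f|_α(ν_i)` of an edgewise family `f` at the vertex `i` along the edge `α`. -/
def vval (N : Network I A) (f : A → ℝ → ℝ) (i : I) (α : A) : ℝ :=
  if N.src α = i then f α 0 else f α (N.ℓ α)

/-- The outward directional derivative `∂_α f(ν_i)`, expressed via the family `f'` of
edgewise first derivatives. -/
def oderiv (N : Network I A) (f' : A → ℝ → ℝ) (i : I) (α : A) : ℝ :=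
  if N.src α = i then -(f' α 0) else f' α (N.ℓ α)

/-- The sign `n_{iα}`: `-1` if `ν_i` is attached to the endpoint `0` of `α`, `+1` if it is
attached to the endpoint `ℓ α`. -/
def sgn (N : Network I A) (i : I) (α : A) : ℝ :=
  if N.src α = i then -1 else 1

/-- `v = (v_α)` is a `C²` function on the network, with first derivatives `v'` and second
derivatives `v''`, continuous at the vertices. -/
def IsC2 (N : Network I A) (v v' v'' : A → ℝ → ℝ) : Prop :=
  (∀ α, ∀ y ∈ Icc (0:ℝ) (N.ℓ α), HasDerivWithinAt (v α) (v' α y) (Icc 0 (N.ℓ α)) y) ∧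
  (∀ α, ∀ y ∈ Icc (0:ℝ) (N.ℓ α), HasDerivWithinAt (v' α) (v'' α y) (Icc 0 (N.ℓ α)) y) ∧
  (∀ α, ContinuousOn (v'' α) (Icc 0 (N.ℓ α))) ∧
  (∀ i : I, ∀ α ∈ N.edges i, ∀ β ∈ N.edges i, N.vval v i α = N.vval v i β)

/-- The Kirchhoff conditions `∑_{α ∈ 𝒜_i} γ_{iα} μ_α ∂_α v(ν_i) = 0` at every vertex. -/
def Kirchhoff (N : Network I A) (μ : A → ℝ) (γ : I → A → ℝ) (v' : A → ℝ → ℝ) : Prop :=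
  ∀ i : I, ∑ α ∈ N.edges i, γ i α * μ α * N.oderiv v' i α = 0

end Network

namespace Network

variable {I A : Type} [Fintype I] [Fintype A] [DecidableEq I]

/-- A solution of the stationary Fokker–Planck problem on the network associated with the
drift `b`: `m` (with edgewise derivative `m'`) is `C¹` on each edge, satisfies the jump
conditions `m|_α(ν_i)/γ_{iα} = m|_β(ν_i)/γ_{iβ}`, the first integral
`μ_α m_α' + b_α m_α = c_α` on each edge, the vertex transmission conditions
`∑_{α ∈ 𝒜_i} [n_{iα} b|_α(ν_i) m|_α(ν_i) + μ_α ∂_α m(ν_i)] = 0`, is nonnegative and has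
total integral `1`. -/
def IsFPSolution (N : Network I A) (μ : A → ℝ) (γ : I → A → ℝ)
    (b : A → ℝ → ℝ) (m m' : A → ℝ → ℝ) : Prop :=
  (∀ α, ∀ y ∈ Icc (0:ℝ) (N.ℓ α), HasDerivWithinAt (m α) (m' α y) (Icc 0 (N.ℓ α)) y) ∧
  (∀ α, ContinuousOn (m' α) (Icc 0 (N.ℓ α))) ∧
  (∀ i : I, ∀ α ∈ N.edges i, ∀ β ∈ N.edges i,
      N.vval m i α / γ i α = N.vval m i β / γ i β) ∧
  (∀ α, ∃ c : ℝ, ∀ y ∈ Icc (0:ℝ) (N.ℓ α), μ α * m' α y + b α y * m α y = c) ∧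
  (∀ i : I, ∑ α ∈ N.edges i,
      (N.sgn i α * N.vval b i α * N.vval m i α + μ α * N.oderiv m' i α) = 0) ∧
  (∀ α, ∀ y ∈ Icc (0:ℝ) (N.ℓ α), 0 ≤ m α y) ∧
  (∑ α : A, ∫ y in (0:ℝ)..(N.ℓ α), m α y) = 1

/-- The standing assumptions on the Hamiltonians `H_α : [0, ℓ_α] × ℝ → ℝ` with partial
derivatives `Hp_α = ∂_p H_α`: `C¹` regularity, convexity in `p`, coercivity
`H_α(x,p) ≥ C₀|p|^q − C₁` and the growth condition `|∂_p H_α(x,p)| ≤ C₂(|p|^{q−1} + 1)`. -/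
def HamHyp (N : Network I A) (H Hp : A → ℝ → ℝ → ℝ) (q C0 C1 C2 : ℝ) : Prop :=
  (∀ α, ContDiffOn ℝ 1 (fun z : ℝ × ℝ => H α z.1 z.2)
      (Icc (0:ℝ) (N.ℓ α) ×ˢ (univ : Set ℝ))) ∧
  (∀ α, ∀ x ∈ Icc (0:ℝ) (N.ℓ α), ∀ p : ℝ, HasDerivAt (fun p => H α x p) (Hp α x p) p) ∧
  (∀ α, ∀ x ∈ Icc (0:ℝ) (N.ℓ α), ConvexOn ℝ univ (fun p => H α x p)) ∧
  (∀ α, ∀ x ∈ Icc (0:ℝ) (N.ℓ α), ∀ p : ℝ, C0 * |p| ^ q - C1 ≤ H α x p) ∧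
  (∀ α, ∀ x ∈ Icc (0:ℝ) (N.ℓ α), ∀ p : ℝ, |Hp α x p| ≤ C2 * (|p| ^ (q - 1) + 1))

/-- A solution `(v, m, ρ)` of the stationary MFG system on the network: `v` is `C²`,
solves the ergodic HJB equation with coupling `F(m)` and the Kirchhoff conditions; `m` is
`C¹` on each edge, satisfies the jump conditions, the first-integral form of the
Fokker–Planck equation `μ_α m_α' + m_α ∂_p H_α(·, v_α') = c_α` with `∑_{α∈𝒜_i} n_{iα} c_α = 0`
at every vertex, `m ≥ 0`, `∫_Γ m = 1` and `∫_Γ v = 0`. -/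
def IsMFGSolution (N : Network I A) (μ : A → ℝ) (γ : I → A → ℝ)
    (H Hp : A → ℝ → ℝ → ℝ) (F : ℝ → ℝ)
    (v v' v'' m m' : A → ℝ → ℝ) (ρ : ℝ) : Prop :=
  IsC2 N v v' v'' ∧
  (∀ α, ∀ y ∈ Ioo (0:ℝ) (N.ℓ α),
      -(μ α * v'' α y) + H α y (v' α y) + ρ = F (m α y)) ∧
  Kirchhoff N μ γ v' ∧
  (∀ α, ∀ y ∈ Icc (0:ℝ) (N.ℓ α), HasDerivWithinAt (m α) (m' α y) (Icc 0 (N.ℓ α)) y) ∧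
  (∀ α, ContinuousOn (m' α) (Icc 0 (N.ℓ α))) ∧
  (∀ i : I, ∀ α ∈ N.edges i, ∀ β ∈ N.edges i,
      N.vval m i α / γ i α = N.vval m i β / γ i β) ∧
  (∃ c : A → ℝ,
    (∀ α, ∀ y ∈ Icc (0:ℝ) (N.ℓ α), μ α * m' α y + m α y * Hp α y (v' α y) = c α) ∧
    (∀ i : I, ∑ α ∈ N.edges i, N.sgn i α * c α = 0)) ∧
  (∀ α, ∀ y ∈ Icc (0:ℝ) (N.ℓ α), 0 ≤ m α y) ∧
  (∑ α : A, ∫ y in (0:ℝ)..(N.ℓ α), m α y) = 1 ∧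
  (∑ α : A, ∫ y in (0:ℝ)..(N.ℓ α), v α y) = 0

end Network

open scoped Topology

/-- First-order condition at a maximum point of a function on a closed interval. -/
theorem IsMaxOn.hasDerivWithinAt_mul_sub_nonpos {w : ℝ → ℝ} {a b x z d : ℝ}
    (hx : x ∈ Icc a b) (hz : z ∈ Icc a b) (hmax : IsMaxOn w (Icc a b) x)
    (hd : HasDerivWithinAt w d (Icc a b) x) : d * (z - x) ≤ 0 := by
  have h := hmax.localize.hasFDerivWithinAt_nonpos hd.hasFDerivWithinAt
    (sub_mem_posTangentConeAt_of_segment_subset ((convex_Icc a b).segment_subset hx hz))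
  simpa [mul_comm] using h

/-- Second-order condition at a critical maximum point, possibly an endpoint, of a function on
a closed interval. -/
theorem IsMaxOn.second_hasDerivWithinAt_nonpos {w w' : ℝ → ℝ} {a b x d : ℝ} (hab : a < b)
    (hx : x ∈ Icc a b) (hmax : IsMaxOn w (Icc a b) x)
    (hw : ∀ y ∈ Icc a b, HasDerivWithinAt w (w' y) (Icc a b) y)
    (hw' : HasDerivWithinAt w' d (Icc a b) x) (hcrit : w' x = 0) : d ≤ 0 := by
  by_contra! hd
  have hpos : ∀ᶠ c in 𝓝[Icc a b \ {x}] x, 0 < slope w' x c :=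
    (hasDerivWithinAt_iff_tendsto_slope.1 hw').eventually (lt_mem_nhds hd)
  obtain ⟨ε, hε, hball⟩ := Metric.mem_nhdsWithin_iff.1 hpos
  have hslope : ∀ c ∈ Icc a b, |c - x| < ε → c ≠ x → 0 < w' c / (c - x) := by
    intro c hc hcε hcx
    have h : 0 < slope w' x c := hball ⟨by simpa [Real.dist_eq] using hcε, hc, hcx⟩
    simpa [slope_def_field, hcrit] using h
  have hcont : ContinuousOn w (Icc a b) := fun y hy => (hw y hy).continuousWithinAt
  have hderiv : ∀ y ∈ Ioo a b, HasDerivAt w (w' y) y := fun y hy =>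
    (hw y (Ioo_subset_Icc_self hy)).hasDerivAt (Icc_mem_nhds hy.1 hy.2)
  rcases hx.2.lt_or_eq with hxb | hxb
  · obtain ⟨z, hxz, hz⟩ := exists_between (lt_min hxb (show x < x + ε by linarith))
    obtain ⟨hzb, hzε⟩ := lt_min_iff.1 hz
    obtain ⟨c, hc, hce⟩ := exists_hasDerivAt_eq_slope w w' hxz
      (hcont.mono (Icc_subset_Icc hx.1 hzb.le))
      (fun y hy => hderiv y ⟨hx.1.trans_lt hy.1, hy.2.trans hzb⟩)
    have hs := hslope c ⟨hx.1.trans hc.1.le, hc.2.le.trans hzb.le⟩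
      (by rw [abs_lt]; constructor <;> linarith [hc.1, hc.2]) hc.1.ne'
    have hwz : w z ≤ w x := hmax ⟨hx.1.trans hxz.le, hzb.le⟩
    have hcpos : 0 < w' c := (div_pos_iff_of_pos_right (sub_pos.2 hc.1)).1 hs
    have : (w z - w x) / (z - x) ≤ 0 :=
      div_nonpos_of_nonpos_of_nonneg (by linarith) (by linarith)
    linarith
  · have hax : a < x := hxb ▸ hab
    obtain ⟨z, hz, hzx⟩ := exists_between (max_lt hax (show x - ε < x by linarith))
    obtain ⟨haz, hzε⟩ := max_lt_iff.1 hz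
    obtain ⟨c, hc, hce⟩ := exists_hasDerivAt_eq_slope w w' hzx
      (hcont.mono (Icc_subset_Icc haz.le hx.2))
      (fun y hy => hderiv y ⟨haz.trans hy.1, hy.2.trans_le hx.2⟩)
    have hs := hslope c ⟨haz.le.trans hc.1.le, hc.2.le.trans hx.2⟩
      (by rw [abs_lt]; constructor <;> linarith [hc.1, hc.2]) hc.2.ne
    have hwz : w z ≤ w x := hmax ⟨haz.le, hzx.le.trans hx.2⟩
    have hcneg : w' c < 0 := by
      rcases div_pos_iff.1 hs with h | h
      · linarith [h.2, hc.2]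
      · exact h.1
    have : 0 ≤ (w x - w z) / (x - z) := div_nonneg (by linarith) (by linarith)
    linarith

namespace Network

variable {I A : Type} [Fintype I] [Fintype A] [DecidableEq I]

theorem IsC2.sub {N : Network I A} {u u' u'' v v' v'' : A → ℝ → ℝ}
    (hu : N.IsC2 u u' u'') (hv : N.IsC2 v v' v'') :
    N.IsC2 (fun α y => u α y - v α y) (fun α y => u' α y - v' α y)
      (fun α y => u'' α y - v'' α y) := by
  refine ⟨fun α y hy => (hu.1 α y hy).sub (hv.1 α y hy),
    fun α y hy => (hu.2.1 α y hy).sub (hv.2.1 α y hy),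
    fun α => (hu.2.2.1 α).sub (hv.2.2.1 α), fun i α hα β hβ => ?_⟩
  have h1 := hu.2.2.2 i α hα β hβ
  have h2 := hv.2.2.2 i α hα β hβ
  unfold vval at *
  grind

/-- A function on a nonempty network attains its maximum. -/
theorem IsC2.exists_max {N : Network I A} [Nonempty A] {w w' w'' : A → ℝ → ℝ}
    (hw : N.IsC2 w w' w'') :
    ∃ α, ∃ x ∈ Icc 0 (N.ℓ α), ∀ β, ∀ y ∈ Icc 0 (N.ℓ β), w β y ≤ w α x := by
  have hmax : ∀ α, ∃ x ∈ Icc 0 (N.ℓ α), IsMaxOn (w α) (Icc 0 (N.ℓ α)) x := fun α =>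
    isCompact_Icc.exists_isMaxOn (nonempty_Icc.2 (N.ℓ_pos α).le)
      fun y hy => (hw.1 α y hy).continuousWithinAt
  choose x hx hxmax using hmax
  obtain ⟨α, hα⟩ := Finite.exists_max fun α => w α (x α)
  exact ⟨α, x α, hx α, fun β y hy => (hxmax β hy).trans (hα β)⟩

/-- At a vertex where the maximum over the network is attained, the outward derivatives are
nonnegative. -/
theorem IsC2.oderiv_nonneg {N : Network I A} {w w' w'' : A → ℝ → ℝ} (hw : N.IsC2 w w' w'')
    {i : I} {α β : A} (hα : α ∈ N.edges i) (hβ : β ∈ N.edges i)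
    (hmax : ∀ y ∈ Icc 0 (N.ℓ β), w β y ≤ N.vval w i α) : 0 ≤ N.oderiv w' i β := by
  rw [hw.2.2.2 i α hα β hβ] at hmax
  have h0 : (0 : ℝ) ∈ Icc 0 (N.ℓ β) := left_mem_Icc.2 (N.ℓ_pos β).le
  have hℓ : N.ℓ β ∈ Icc 0 (N.ℓ β) := right_mem_Icc.2 (N.ℓ_pos β).le
  have hpos := N.ℓ_pos β
  unfold vval at hmax
  unfold oderiv
  split_ifs at hmax ⊢
  · have h := IsMaxOn.hasDerivWithinAt_mul_sub_nonpos h0 hℓ hmax (hw.1 β 0 h0)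
    nlinarith
  · have h := IsMaxOn.hasDerivWithinAt_mul_sub_nonpos hℓ h0 hmax (hw.1 β _ hℓ)
    nlinarith

/-- Under the Kirchhoff inequality, the outward derivatives vanish at a vertex where the maximum
over the network is attained. -/
theorem IsC2.oderiv_eq_zero {N : Network I A} {w w' w'' : A → ℝ → ℝ} (hw : N.IsC2 w w' w'')
    {c : A → ℝ} {i : I} {α : A} (hc : ∀ β ∈ N.edges i, 0 < c β)
    (hkir : ∑ β ∈ N.edges i, c β * N.oderiv w' i β ≤ 0) (hα : α ∈ N.edges i)
    (hmax : ∀ β, ∀ y ∈ Icc 0 (N.ℓ β), w β y ≤ N.vval w i α) : N.oderiv w' i α = 0 := by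
  have hnonneg : ∀ β ∈ N.edges i, 0 ≤ c β * N.oderiv w' i β := fun β hβ =>
    mul_nonneg (hc β hβ).le (hw.oderiv_nonneg hα hβ (hmax β))
  have hzero := (Finset.sum_eq_zero_iff_of_nonneg hnonneg).1
    (le_antisymm hkir (Finset.sum_nonneg hnonneg)) α hα
  exact (mul_eq_zero.1 hzero).resolve_left (hc α hα).ne'

/-- Under the Kirchhoff inequalities, the derivative vanishes wherever the maximum over the
network is attained, vertices included. -/
theorem IsC2.deriv_eq_zero_of_max {N : Network I A} {w w' w'' : A → ℝ → ℝ}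
    (hw : N.IsC2 w w' w'') {c : I → A → ℝ} (hc : ∀ i, ∀ β ∈ N.edges i, 0 < c i β)
    (hkir : ∀ i, ∑ β ∈ N.edges i, c i β * N.oderiv w' i β ≤ 0) {α : A} {x : ℝ}
    (hx : x ∈ Icc 0 (N.ℓ α)) (hmax : ∀ β, ∀ y ∈ Icc 0 (N.ℓ β), w β y ≤ w α x) :
    w' α x = 0 := by
  rcases hx.1.eq_or_lt with rfl | h0
  · have h := hw.oderiv_eq_zero (hc (N.src α)) (hkir (N.src α)) (α := α) (by simp [edges])
      (by simpa [vval] using hmax)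
    simpa [oderiv] using h
  rcases hx.2.eq_or_lt with rfl | hℓ
  · have h := hw.oderiv_eq_zero (hc (N.tgt α)) (hkir (N.tgt α)) (α := α) (by simp [edges])
      (by simpa [vval, N.src_ne_tgt α] using hmax)
    simpa [oderiv, N.src_ne_tgt α] using h
  · have hmem : Icc 0 (N.ℓ α) ∈ 𝓝 x := Icc_mem_nhds h0 hℓ
    have hloc : IsLocalMax (w α) x := Filter.mem_of_superset hmem (hmax α)
    exact hloc.hasDerivAt_eq_zero ((hw.1 α x hx).hasDerivAt hmem)

/-- The Hamiltonian operator is continuous up to the endpoints of each edge. -/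
theorem IsC2.continuousOn_hamiltonian {N : Network I A} {v v' v'' : A → ℝ → ℝ}
    (hv : N.IsC2 v v' v'') {α : A} {h : ℝ → ℝ → ℝ} (m lam : ℝ)
    (hh : ContinuousOn (fun z : ℝ × ℝ => h z.1 z.2) (Icc (0 : ℝ) (N.ℓ α) ×ˢ univ)) :
    ContinuousOn (fun y => -(m * v'' α y) + h y (v' α y) + lam * v α y) (Icc 0 (N.ℓ α)) := by
  have h0 : ContinuousOn (v α) (Icc 0 (N.ℓ α)) := fun y hy => (hv.1 α y hy).continuousWithinAt
  have h1 : ContinuousOn (v' α) (Icc 0 (N.ℓ α)) := fun y hy =>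
    (hv.2.1 α y hy).continuousWithinAt
  have hH : ContinuousOn (fun y => h y (v' α y)) (Icc 0 (N.ℓ α)) :=
    hh.comp (continuousOn_id.prodMk h1) fun y hy => ⟨hy, mem_univ _⟩
  exact ((continuousOn_const.mul (hv.2.2.1 α)).neg.add hH).add (continuousOn_const.mul h0)

end Network

/-- comparison principle: if `v` is a supersolution relative to `u` (both in
the PDE on every edge and in the Kirchhoff conditions at every vertex), then `v ≥ u`. -/
theorem stmt_9 {I A : Type} [Fintype I] [Fintype A] [DecidableEq I]
    (N : Network I A) (μ : A → ℝ) (γ : I → A → ℝ)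
    (hμ : ∀ α, 0 < μ α) (hγ : ∀ i : I, ∀ α ∈ N.edges i, 0 < γ i α)
    (lam : ℝ) (hlam : 0 < lam)
    (H : A → ℝ → ℝ → ℝ)
    (hHcont : ∀ α, ContinuousOn (fun z : ℝ × ℝ => H α z.1 z.2)
      (Icc (0:ℝ) (N.ℓ α) ×ˢ (univ : Set ℝ)))
    (v v' v'' u u' u'' : A → ℝ → ℝ)
    (hv : Network.IsC2 N v v' v'') (hu : Network.IsC2 N u u' u'')
    (hineq : ∀ α : A, ∀ y ∈ Ioo (0:ℝ) (N.ℓ α),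
      -(μ α * u'' α y) + H α y (u' α y) + lam * u α y ≤
        -(μ α * v'' α y) + H α y (v' α y) + lam * v α y)
    (hkir : ∀ i : I, ∑ α ∈ N.edges i, γ i α * μ α * N.oderiv u' i α ≤
        ∑ α ∈ N.edges i, γ i α * μ α * N.oderiv v' i α) :
    ∀ α : A, ∀ y ∈ Icc (0:ℝ) (N.ℓ α), u α y ≤ v α y := by
  intro α y hy
  have : Nonempty A := ⟨α⟩
  have hw := hu.sub hv
  obtain ⟨β, x, hx, hmax⟩ := hw.exists_max
  refine sub_nonpos.1 ((hmax α y hy).trans ?_)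
  by_contra! hpos
  have hkir' : ∀ i, ∑ β ∈ N.edges i,
      γ i β * μ β * N.oderiv (fun α y => u' α y - v' α y) i β ≤ 0 := by
    intro i
    have h : ∀ β, N.oderiv (fun α y => u' α y - v' α y) i β =
        N.oderiv u' i β - N.oderiv v' i β := by
      intro β
      unfold Network.oderiv
      split_ifs <;> ring
    simpa only [h, mul_sub, Finset.sum_sub_distrib, sub_nonpos] using hkir i
  have hcrit := hw.deriv_eq_zero_of_max
    (c := fun i β => γ i β * μ β) (fun i β hβ => mul_pos (hγ i β hβ) (hμ β)) hkir' hx hmax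
  have hsecond := IsMaxOn.second_hasDerivWithinAt_nonpos (N.ℓ_pos β) hx (hmax β)
    (hw.1 β) (hw.2.1 β x hx) hcrit
  have hclosure : closure (Ioo 0 (N.ℓ β)) = Icc 0 (N.ℓ β) := closure_Ioo (N.ℓ_pos β).ne
  have hx_ineq := le_on_closure (hineq β)
    (hclosure ▸ hu.continuousOn_hamiltonian (μ β) lam (hHcont β))
    (hclosure ▸ hv.continuousOn_hamiltonian (μ β) lam (hHcont β)) (hclosure ▸ hx)
  simp only [sub_eq_zero.1 hcrit] at hx_ineq
  nlinarith [mul_nonpos_of_nonneg_of_nonpos (hμ β).le hsecond, mul_pos hlam hpos]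
end

section
/- Let λ > 0 and, for each α ∈ 𝒜, let H_α : [0, ℓ_α] × ℝ → ℝ be continuous with |H_α(x, p)| ≤ C₂(1 + p²) for all (x, p), for some constant C₂ > 0. Then there exists v ∈ C²(Γ) such that −μ_α v_α''(y) + H_α(y, v_α'(y)) + λ v_α(y) = 0 for all y ∈ (0, ℓ_α) and all α ∈ 𝒜, and the Kirchhoff conditions ∑_{α∈𝒜_i} γ_iα μ_α ∂_α v(ν_i) = 0 hold at every vertex ν_i, i ∈ I. Moreover, if each H_α is locally Lipschitz on [0, ℓ_α] × ℝ (with respect to both variables), then v can be taken so that in addition v_α'' is Lipschitz continuous on [0, ℓ_α] for every α ∈ 𝒜. -/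
open Set

theorem exists_first_eq {f : ℝ → ℝ} {a b c : ℝ} (hab : a ≤ b) (hf : ContinuousOn f (Icc a b))
    (ha : c ≤ f a) (hb : f b ≤ c) :
    ∃ t ∈ Icc a b, f t = c ∧ ∀ s ∈ Icc a t, c ≤ f s := by
  have hS : IsCompact (Icc a b ∩ f ⁻¹' Iic c) :=
    isCompact_Icc.of_isClosed_subset (hf.preimage_isClosed_of_isClosed isClosed_Icc isClosed_Iic)
      inter_subset_left
  obtain ⟨t, ⟨ht, htc⟩, hmin⟩ := hS.exists_isLeast ⟨b, ⟨hab, le_rfl⟩, hb⟩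
  obtain ⟨u, hu, huc⟩ := intermediate_value_Icc' ht.1 (hf.mono (Icc_subset_Icc_right ht.2)) ⟨htc, ha⟩
  have hut : u = t := le_antisymm hu.2 (hmin ⟨⟨hu.1, hu.2.trans ht.2⟩, huc.le⟩)
  subst hut
  refine ⟨u, ht, huc, fun s hs => ?_⟩
  by_contra! h
  have := hmin ⟨⟨hs.1, hs.2.trans ht.2⟩, h.le⟩
  rw [le_antisymm hs.2 this, huc] at h
  exact lt_irrefl _ h

theorem exists_last_eq {f : ℝ → ℝ} {a b c : ℝ} (hab : a ≤ b) (hf : ContinuousOn f (Icc a b))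
    (ha : f a ≤ c) (hb : c ≤ f b) :
    ∃ t ∈ Icc a b, f t = c ∧ ∀ s ∈ Icc t b, c ≤ f s := by
  have hmaps : MapsTo (fun t => a + b - t) (Icc a b) (Icc a b) :=
    fun t ht => ⟨by linarith [ht.2], by linarith [ht.1]⟩
  obtain ⟨t, ht, htc, h⟩ := exists_first_eq (f := fun t => f (a + b - t)) (c := c) hab
    (hf.comp (by fun_prop) hmaps) (by simpa using hb) (by simpa using ha)
  refine ⟨a + b - t, hmaps ht, htc, fun s hs => ?_⟩
  simpa using h (a + b - s) ⟨by linarith [hs.2], by linarith [hs.1]⟩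

/-- On `[a, b]` the function `w` has derivative `w'`, which in turn has derivative `w''`. -/
structure HasSecondDeriv (w w' w'' : ℝ → ℝ) (a b : ℝ) : Prop where
  fst : ∀ t ∈ Icc a b, HasDerivWithinAt w (w' t) (Icc a b) t
  snd : ∀ t ∈ Icc a b, HasDerivWithinAt w' (w'' t) (Icc a b) t

namespace HasSecondDeriv

variable {w w' w'' u u' u'' : ℝ → ℝ} {a b K : ℝ}

theorem continuousOn (h : HasSecondDeriv w w' w'' a b) : ContinuousOn w (Icc a b) :=
  fun t ht => (h.fst t ht).continuousWithinAt

theorem continuousOn_deriv (h : HasSecondDeriv w w' w'' a b) : ContinuousOn w' (Icc a b) :=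
  fun t ht => (h.snd t ht).continuousWithinAt

theorem mono (h : HasSecondDeriv w w' w'' a b) {c d : ℝ} (hc : a ≤ c) (hd : d ≤ b) :
    HasSecondDeriv w w' w'' c d :=
  ⟨fun t ht => (h.fst t (Icc_subset_Icc hc hd ht)).mono (Icc_subset_Icc hc hd),
    fun t ht => (h.snd t (Icc_subset_Icc hc hd ht)).mono (Icc_subset_Icc hc hd)⟩

theorem neg (h : HasSecondDeriv w w' w'' a b) :
    HasSecondDeriv (fun t => -w t) (fun t => -w' t) (fun t => -w'' t) a b :=
  ⟨fun t ht => (h.fst t ht).fun_neg, fun t ht => (h.snd t ht).fun_neg⟩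

theorem sub (h : HasSecondDeriv w w' w'' a b) (k : HasSecondDeriv u u' u'' a b) :
    HasSecondDeriv (fun t => w t - u t) (fun t => w' t - u' t) (fun t => w'' t - u'' t) a b :=
  ⟨fun t ht => (h.fst t ht).fun_sub (k.fst t ht), fun t ht => (h.snd t ht).fun_sub (k.snd t ht)⟩

theorem sub_const (h : HasSecondDeriv w w' w'' a b) (c : ℝ) :
    HasSecondDeriv (fun t => w t - c) w' w'' a b :=
  ⟨fun t ht => (h.fst t ht).sub_const c, h.snd⟩

theorem reflect (h : HasSecondDeriv w w' w'' a b) :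
    HasSecondDeriv (fun t => w (a + b - t)) (fun t => -w' (a + b - t))
      (fun t => w'' (a + b - t)) a b := by
  have hmaps : MapsTo (fun t => a + b - t) (Icc a b) (Icc a b) :=
    fun t ht => ⟨by linarith [ht.2], by linarith [ht.1]⟩
  have hd : ∀ t, HasDerivWithinAt (fun t => a + b - t) (-1) (Icc a b) t :=
    fun t => ((hasDerivAt_id t).const_sub (a + b)).hasDerivWithinAt
  refine ⟨fun t ht => ?_, fun t ht => ?_⟩
  · exact ((h.fst _ (hmaps ht)).comp t (hd t) hmaps).congr_deriv (by ring)
  · simpa using ((h.snd _ (hmaps ht)).comp t (hd t) hmaps).fun_neg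

/-- If `w'' ≥ -K w'` wherever `w, w' ≥ 0`, then a solution starting at a nonnegative value
with positive slope keeps growing at a definite rate. -/
theorem add_mul_le (h : HasSecondDeriv w w' w'' a b) (hab : a ≤ b)
    (hw : ∀ t ∈ Icc a b, 0 ≤ w t → 0 ≤ w' t → -(K * w' t) ≤ w'' t)
    (hK : 0 ≤ K) (ha : 0 ≤ w a) (ha' : 0 < w' a) :
    w a + w' a * (Real.exp (-(K * (b - a))) * (b - a)) ≤ w b := by
  have key : ∀ T ∈ Icc a b, (∀ t ∈ Icc a T, 0 ≤ w' t) →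
      w' a ≤ w' T * Real.exp (K * (T - a)) := by
    intro T hT hpos
    have hT' := h.mono le_rfl hT.2
    have hwmono : MonotoneOn w (Icc a T) :=
      monotoneOn_of_hasDerivWithinAt_nonneg (convex_Icc a T) hT'.continuousOn
        (fun x hx => (hT'.fst x (interior_subset hx)).mono interior_subset)
        (fun x hx => hpos x (interior_subset hx))
    have hd : ∀ t ∈ Icc a T, HasDerivWithinAt (fun t => w' t * Real.exp (K * (t - a)))
        ((w'' t + K * w' t) * Real.exp (K * (t - a))) (Icc a T) t := by
      intro t ht
      have h1 : HasDerivWithinAt (fun t => K * (t - a)) (K * 1) (Icc a T) t :=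
        (((hasDerivAt_id t).sub_const a).const_mul K).hasDerivWithinAt
      refine ((hT'.snd t ht).fun_mul h1.exp).congr_deriv ?_
      ring
    have hm : MonotoneOn (fun t => w' t * Real.exp (K * (t - a))) (Icc a T) := by
      refine monotoneOn_of_hasDerivWithinAt_nonneg (convex_Icc a T)
        (fun t ht => (hd t ht).continuousWithinAt)
        (fun x hx => (hd x (interior_subset hx)).mono interior_subset) (fun x hx => ?_)
      have hx' := interior_subset hx
      have hw0 : 0 ≤ w x := ha.trans (hwmono (left_mem_Icc.2 hT.1) hx' hx'.1)
      have := hw x ⟨hx'.1, hx'.2.trans hT.2⟩ hw0 (hpos x hx')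
      exact mul_nonneg (by linarith) (Real.exp_pos _).le
    simpa using hm (left_mem_Icc.2 hT.1) (right_mem_Icc.2 hT.1) hT.1
  have hpos : ∀ t ∈ Icc a b, 0 < w' t := by
    intro t ht
    by_contra! hneg
    obtain ⟨T, hT, hT0, hTpos⟩ := exists_first_eq ht.1
      (h.mono le_rfl ht.2).continuousOn_deriv ha'.le hneg
    have := key T ⟨hT.1, hT.2.trans ht.2⟩ hTpos
    rw [hT0] at this
    linarith
  have hlow : ∀ t ∈ Icc a b, w' a * Real.exp (-(K * (b - a))) ≤ w' t := by
    intro t ht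
    have h1 := key t ht fun s hs => (hpos s ⟨hs.1, hs.2.trans ht.2⟩).le
    have h2 : Real.exp (K * (t - a)) ≤ Real.exp (K * (b - a)) := by
      gcongr
      exact ht.2
    have h3 : w' a ≤ w' t * Real.exp (K * (b - a)) :=
      h1.trans (mul_le_mul_of_nonneg_left h2 (hpos t ht).le)
    rw [Real.exp_neg, ← div_eq_mul_inv, div_le_iff₀ (Real.exp_pos _)]
    exact h3
  have hm : MonotoneOn (fun t => w t - w' a * Real.exp (-(K * (b - a))) * t) (Icc a b) := by
    have hd : ∀ t ∈ Icc a b, HasDerivWithinAt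
        (fun t => w t - w' a * Real.exp (-(K * (b - a))) * t)
        (w' t - w' a * Real.exp (-(K * (b - a))) * 1) (Icc a b) t := fun t ht =>
      (h.fst t ht).fun_sub ((hasDerivWithinAt_id t _).const_mul _)
    refine monotoneOn_of_hasDerivWithinAt_nonneg (convex_Icc a b)
      (fun t ht => (hd t ht).continuousWithinAt)
      (fun x hx => (hd x (interior_subset hx)).mono interior_subset) (fun x hx => ?_)
    linarith [hlow x (interior_subset hx)]
  have := hm (left_mem_Icc.2 hab) (right_mem_Icc.2 hab) hab
  simp only at this
  linarith

theorem deriv_left_nonpos (h : HasSecondDeriv w w' w'' a b) (hab : a < b)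
    (hw : ∀ t ∈ Icc a b, 0 ≤ w t → -(K * |w' t|) ≤ w'' t)
    (hK : 0 ≤ K) (ha : 0 ≤ w a) (hb : w b ≤ 0) : w' a ≤ 0 := by
  by_contra! h0
  have := h.add_mul_le hab.le (fun t ht h1 h2 => by simpa [abs_of_nonneg h2] using hw t ht h1)
    hK ha h0
  have : 0 < w' a * (Real.exp (-(K * (b - a))) * (b - a)) :=
    mul_pos h0 (mul_pos (Real.exp_pos _) (sub_pos.2 hab))
  linarith

theorem deriv_right_nonneg (h : HasSecondDeriv w w' w'' a b) (hab : a < b)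
    (hw : ∀ t ∈ Icc a b, 0 ≤ w t → -(K * |w' t|) ≤ w'' t)
    (hK : 0 ≤ K) (ha : w a ≤ 0) (hb : 0 ≤ w b) : 0 ≤ w' b := by
  have := h.reflect.deriv_left_nonpos hab (K := K)
    (fun t ht h0 => by
      rw [abs_neg]
      exact hw _ ⟨by linarith [ht.2], by linarith [ht.1]⟩ h0) hK (by simpa using hb)
    (by simpa using ha)
  simpa using this

theorem nonpos_of_boundary (h : HasSecondDeriv w w' w'' a b)
    (hw : ∀ t ∈ Icc a b, 0 ≤ w t → -(K * |w' t|) ≤ w'' t)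
    (hK : 0 ≤ K) (ha : w a ≤ 0) (hb : w b ≤ 0) : ∀ t ∈ Icc a b, w t ≤ 0 := by
  intro T hT
  by_contra! hpos
  obtain ⟨t, ht, ht0, htpos⟩ := exists_last_eq hT.1 (h.mono le_rfl hT.2).continuousOn ha hpos.le
  have htT : t < T := by
    rcases ht.2.lt_or_eq with h1 | h1
    · exact h1
    · rw [← h1, ht0] at hpos
      exact absurd hpos (lt_irrefl _)
  have hsub := h.mono ht.1 hT.2
  obtain ⟨ξ, hξ, hξ'⟩ := exists_hasDerivAt_eq_slope w w' htT hsub.continuousOn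
    (fun x hx => (hsub.fst x (Ioo_subset_Icc_self hx)).hasDerivAt (Icc_mem_nhds hx.1 hx.2))
  have hξpos : 0 < w' ξ := by
    rw [hξ', ht0]
    exact div_pos (by linarith) (by linarith)
  have h2 := h.mono (c := ξ) (d := b) (ht.1.trans hξ.1.le) le_rfl
  have hξb : ξ < b := hξ.2.trans_le hT.2
  have := h2.deriv_left_nonpos hξb (fun s hs => hw s ⟨(ht.1.trans hξ.1.le).trans hs.1, hs.2⟩) hK
    (htpos ξ (Ioo_subset_Icc_self hξ)) hb
  linarith

end HasSecondDeriv

/-- A nonlinearity `g t v p` for the equation `v'' = g t v v'`: continuous in `t`, Lipschitz and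
nondecreasing in the relevant variables, bounded, and with constant barriers `±M`. -/
structure IsEdgeField (g : ℝ → ℝ → ℝ → ℝ) (K : NNReal) (B M : ℝ) : Prop where
  cont : ∀ v p, Continuous fun t => g t v p
  lip : ∀ t, LipschitzWith K fun z : ℝ × ℝ => g t z.1 z.2
  mono : ∀ t p, Monotone fun v => g t v p
  bdd : ∀ t v p, |g t v p| ≤ B
  upper : ∀ t, 0 ≤ g t M 0
  lower : ∀ t, g t (-M) 0 ≤ 0

/-- `v`, with derivative `p`, solves `v'' = g t v v'` on `[0, ℓ]`. -/
def IsEdgeSol (g : ℝ → ℝ → ℝ → ℝ) (ℓ : ℝ) (v p : ℝ → ℝ) : Prop :=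
  HasSecondDeriv v p (fun t => g t (v t) (p t)) 0 ℓ

namespace IsEdgeField

variable {g : ℝ → ℝ → ℝ → ℝ} {K : NNReal} {B M ℓ : ℝ} {v p v₁ p₁ v₂ p₂ : ℝ → ℝ}

theorem abs_sub_le (hg : IsEdgeField g K B M) (t v p q : ℝ) :
    |g t v p - g t v q| ≤ K * |p - q| := by
  simpa [Real.dist_eq, Prod.dist_eq] using (hg.lip t).dist_le_mul (v, p) (v, q)

theorem neg_le_of_le (hg : IsEdgeField g K B M) {t a b p q : ℝ} (h : 0 ≤ a - b) :
    -(K * |p - q|) ≤ g t a p - g t b q := by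
  have h1 : g t b p ≤ g t a p := hg.mono t p (sub_nonneg.1 h)
  have h2 := abs_le.1 (hg.abs_sub_le t b p q)
  linarith [h2.1]

theorem deriv_left_le (hg : IsEdgeField g K B M) (hℓ : 0 < ℓ) (h₁ : IsEdgeSol g ℓ v₁ p₁)
    (h₂ : IsEdgeSol g ℓ v₂ p₂) (h0 : v₁ 0 = v₂ 0) (hℓ' : v₁ ℓ ≤ v₂ ℓ) : p₁ 0 ≤ p₂ 0 := by
  have := (HasSecondDeriv.sub h₁ h₂).deriv_left_nonpos hℓ (K := K)
    (fun t _ ht => hg.neg_le_of_le ht) K.2 (by simp [h0]) (by linarith)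
  linarith

theorem le_deriv_right (hg : IsEdgeField g K B M) (hℓ : 0 < ℓ) (h₁ : IsEdgeSol g ℓ v₁ p₁)
    (h₂ : IsEdgeSol g ℓ v₂ p₂) (h0 : v₁ 0 ≤ v₂ 0) (hℓ' : v₁ ℓ = v₂ ℓ) : p₂ ℓ ≤ p₁ ℓ := by
  have := (HasSecondDeriv.sub h₁ h₂).deriv_right_nonneg hℓ (K := K)
    (fun t _ ht => hg.neg_le_of_le ht) K.2 (by linarith) (by simp [hℓ'])
  linarith

theorem neg_le_sub_barrier (hg : IsEdgeField g K B M) {t a p : ℝ} (h : 0 ≤ a - M) :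
    -(K * |p|) ≤ g t a p := by
  have := hg.neg_le_of_le (t := t) (p := p) (q := 0) h
  rw [sub_zero] at this
  linarith [hg.upper t]

theorem neg_le_neg_sub_barrier (hg : IsEdgeField g K B M) {t a p : ℝ} (h : 0 ≤ -a - M) :
    -(K * |-p|) ≤ -g t a p := by
  have := hg.neg_le_of_le (t := t) (p := 0) (q := p) (a := -M) (b := a) (by linarith)
  rw [zero_sub] at this
  linarith [hg.lower t]

theorem deriv_left_nonpos (hg : IsEdgeField g K B M) (hℓ : 0 < ℓ) (h : IsEdgeSol g ℓ v p)
    (h0 : v 0 = M) (hℓ' : v ℓ ≤ M) : p 0 ≤ 0 :=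
  (HasSecondDeriv.sub_const h M).deriv_left_nonpos hℓ (K := K)
    (fun _ _ ht => hg.neg_le_sub_barrier ht) K.2 (by simp [h0]) (by linarith)

theorem deriv_right_nonneg (hg : IsEdgeField g K B M) (hℓ : 0 < ℓ) (h : IsEdgeSol g ℓ v p)
    (h0 : v 0 ≤ M) (hℓ' : v ℓ = M) : 0 ≤ p ℓ :=
  (HasSecondDeriv.sub_const h M).deriv_right_nonneg hℓ (K := K)
    (fun _ _ ht => hg.neg_le_sub_barrier ht) K.2 (by linarith) (by simp [hℓ'])

theorem deriv_left_nonneg (hg : IsEdgeField g K B M) (hℓ : 0 < ℓ) (h : IsEdgeSol g ℓ v p)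
    (h0 : v 0 = -M) (hℓ' : -M ≤ v ℓ) : 0 ≤ p 0 := by
  have := ((HasSecondDeriv.neg h).sub_const M).deriv_left_nonpos hℓ (K := K)
    (fun _ _ ht => hg.neg_le_neg_sub_barrier ht) K.2 (by simp [h0]) (by linarith)
  linarith

theorem deriv_right_nonpos (hg : IsEdgeField g K B M) (hℓ : 0 < ℓ) (h : IsEdgeSol g ℓ v p)
    (h0 : -M ≤ v 0) (hℓ' : v ℓ = -M) : p ℓ ≤ 0 := by
  have := ((HasSecondDeriv.neg h).sub_const M).deriv_right_nonneg hℓ (K := K)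
    (fun _ _ ht => hg.neg_le_neg_sub_barrier ht) K.2 (by linarith) (by simp [hℓ'])
  linarith

theorem abs_le_of_boundary (hg : IsEdgeField g K B M) (h : IsEdgeSol g ℓ v p)
    (h0 : |v 0| ≤ M) (hℓ' : |v ℓ| ≤ M) : ∀ t ∈ Icc 0 ℓ, |v t| ≤ M := by
  intro t ht
  rw [abs_le] at *
  have h1 := (HasSecondDeriv.sub_const h M).nonpos_of_boundary (K := K)
    (fun _ _ ht => hg.neg_le_sub_barrier ht) K.2 (by linarith) (by linarith) t ht
  have h2 := ((HasSecondDeriv.neg h).sub_const M).nonpos_of_boundary (K := K)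
    (fun _ _ ht => hg.neg_le_neg_sub_barrier ht) K.2 (by linarith) (by linarith) t ht
  constructor <;> linarith

theorem exists_ivp (hg : IsEdgeField g K B M) (hℓ : 0 < ℓ) (a s : ℝ) :
    ∃ v p : ℝ → ℝ, IsEdgeSol g ℓ v p ∧ v 0 = a ∧ p 0 = s := by
  have hB : 0 ≤ B := (abs_nonneg _).trans (hg.bdd 0 0 0)
  obtain ⟨P, hP⟩ : ∃ P, P = |s| + B * ℓ := ⟨_, rfl⟩
  have hP0 : 0 ≤ P := by rw [hP]; positivity
  let F : ℝ → ℝ × ℝ → ℝ × ℝ := fun t z => (max (-P) (min z.2 P), g t z.1 z.2)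
  have hF : ∀ t, LipschitzWith (max 1 K) (F t) := fun t =>
    ((LipschitzWith.prod_snd.min_const P).const_max (-P)).prodMk (hg.lip t)
  have hpl : IsPicardLindelof F (⟨0, le_rfl, hℓ.le⟩ : Icc 0 ℓ) (a, s)
      (Real.toNNReal (max P B * ℓ)) 0 (Real.toNNReal (max P B)) (max 1 K) := by
    refine ⟨fun t _ => (hF t).lipschitzOnWith, fun z _ => ?_, fun t _ z _ => ?_, ?_⟩
    · exact (continuous_const.prodMk (hg.cont z.1 z.2)).continuousOn
    · rw [Real.coe_toNNReal _ (hP0.trans (le_max_left _ _)), Prod.norm_def]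
      refine max_le_max ?_ (hg.bdd _ _ _)
      rw [Real.norm_eq_abs, abs_le]
      exact ⟨le_max_left _ _, max_le (by linarith) (min_le_right _ _)⟩
    · have h1 : 0 ≤ max P B := hP0.trans (le_max_left _ _)
      rw [Real.coe_toNNReal _ h1, Real.coe_toNNReal _ (mul_nonneg h1 hℓ.le)]
      simp [hℓ.le]
  obtain ⟨z, hz0, hz⟩ := hpl.exists_eq_forall_mem_Icc_hasDerivWithinAt₀
  simp only at hz0
  have h1 : ∀ t ∈ Icc 0 ℓ, HasDerivWithinAt (fun t => (z t).1)
      (max (-P) (min (z t).2 P)) (Icc 0 ℓ) t := fun t ht => (hz t ht).fst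
  have h2 : ∀ t ∈ Icc 0 ℓ, HasDerivWithinAt (fun t => (z t).2)
      (g t (z t).1 (z t).2) (Icc 0 ℓ) t := fun t ht => (hz t ht).snd
  refine ⟨fun t => (z t).1, fun t => (z t).2, ⟨fun t ht => ?_, h2⟩, by simp [hz0], by simp [hz0]⟩
  refine (h1 t ht).congr_deriv ?_
  have h3 := (convex_Icc 0 ℓ).norm_image_sub_le_of_norm_hasDerivWithin_le h2
    (fun t _ => hg.bdd t _ _) (left_mem_Icc.2 hℓ.le) ht
  have h4 : |(z t).2 - s| ≤ B * ℓ := by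
    rw [hz0, Real.norm_eq_abs, Real.norm_eq_abs, sub_zero, abs_of_nonneg ht.1] at h3
    exact h3.trans (mul_le_mul_of_nonneg_left ht.2 hB)
  have h5 : |(z t).2| ≤ P := by
    have := abs_add_le ((z t).2 - s) s
    rw [sub_add_cancel] at this
    linarith
  rw [abs_le] at h5
  rw [min_eq_left h5.2, max_eq_right h5.1]

theorem dist_le (hg : IsEdgeField g K B M) (h₁ : IsEdgeSol g ℓ v₁ p₁) (h₂ : IsEdgeSol g ℓ v₂ p₂)
    (hℓ : 0 < ℓ) :
    dist (v₁ ℓ, p₁ ℓ) (v₂ ℓ, p₂ ℓ) ≤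
      dist (v₁ 0, p₁ 0) (v₂ 0, p₂ 0) * Real.exp (max 1 K * ℓ) := by
  have hF : ∀ t, LipschitzWith (max 1 K) fun z : ℝ × ℝ => (z.2, g t z.1 z.2) := fun t =>
    LipschitzWith.prod_snd.prodMk (hg.lip t)
  have hd : ∀ {v p : ℝ → ℝ}, IsEdgeSol g ℓ v p → ∀ t ∈ Icc 0 ℓ,
      HasDerivWithinAt (fun t => (v t, p t)) (p t, g t (v t) (p t)) (Icc 0 ℓ) t :=
    fun h t ht => (h.fst t ht).prodMk (h.snd t ht)
  have hd' : ∀ {v p : ℝ → ℝ}, IsEdgeSol g ℓ v p → ∀ t ∈ Ico 0 ℓ,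
      HasDerivWithinAt (fun t => (v t, p t)) (p t, g t (v t) (p t)) (Ici t) t :=
    fun h t ht => (hd h t (Ico_subset_Icc_self ht)).mono_of_mem_nhdsWithin
      (Icc_mem_nhdsGE_of_mem ht)
  have := dist_le_of_trajectories_ODE hF (fun t ht => (hd h₁ t ht).continuousWithinAt) (hd' h₁)
    (fun t ht => (hd h₂ t ht).continuousWithinAt) (hd' h₂) le_rfl ℓ (right_mem_Icc.2 hℓ.le)
  simpa using this

/-- Solvability of the Dirichlet problem on an edge, with endpoint slopes depending continuously
on the boundary values. -/
theorem exists_dirichlet (hg : IsEdgeField g K B M) (hℓ : 0 < ℓ) :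
    ∃ v p : ℝ × ℝ → ℝ → ℝ, (∀ x, IsEdgeSol g ℓ (v x) (p x) ∧ v x 0 = x.1 ∧ v x ℓ = x.2) ∧
      Continuous (fun x => p x 0) ∧ Continuous (fun x => p x ℓ) := by
  choose v p hs hv0 hp0 using hg.exists_ivp hℓ
  set E := Real.exp (max 1 K * ℓ)
  have hE : 0 < E := Real.exp_pos _
  have hdist : ∀ a s a' s', dist (v a s ℓ, p a s ℓ) (v a' s' ℓ, p a' s' ℓ) ≤
      dist (a, s) (a', s') * E := fun a s a' s' => by
    have := hg.dist_le (hs a s) (hs a' s') hℓ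
    rwa [hv0, hv0, hp0, hp0] at this
  have hcont : Continuous fun z : ℝ × ℝ => (v z.1 z.2 ℓ, p z.1 z.2 ℓ) := by
    refine (LipschitzWith.of_dist_le_mul (K := ⟨E, hE.le⟩) fun z z' => ?_).continuous
    rw [mul_comm]
    exact hdist _ _ _ _
  obtain ⟨c, hc⟩ : ∃ c, c = Real.exp (-(K * (ℓ - 0))) * (ℓ - 0) := ⟨_, rfl⟩
  have hc0 : 0 < c := by rw [hc]; exact mul_pos (Real.exp_pos _) (by linarith)
  have hexp : ∀ a s s', s < s' → v a s ℓ + (s' - s) * c ≤ v a s' ℓ := by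
    intro a s s' hlt
    have := (HasSecondDeriv.sub (hs a s') (hs a s)).add_mul_le hℓ.le (K := K)
      (fun t _ h0 h1 => by
        have := hg.neg_le_of_le (t := t) (p := p a s' t) (q := p a s t) h0
        rwa [abs_of_nonneg h1] at this)
      K.2 (by simp [hv0]) (by simpa [hp0] using hlt)
    rw [← hc, hv0, hv0, hp0, hp0] at this
    linarith
  have hexp' : ∀ a s s', |s - s'| * c ≤ |v a s ℓ - v a s' ℓ| := by
    intro a s s'
    rcases lt_trichotomy s s' with h | h | h
    · have := hexp a s s' h
      rw [abs_sub_comm, abs_of_pos (sub_pos.2 h), abs_sub_comm]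
      exact le_trans (by linarith) (le_abs_self _)
    · simp [h]
    · have := hexp a s' s h
      rw [abs_of_pos (sub_pos.2 h)]
      exact le_trans (by linarith) (le_abs_self _)
  have hsurj : ∀ a b, ∃ s, v a s ℓ = b := by
    intro a b
    have hca : Continuous fun s => v a s ℓ :=
      (continuous_fst.comp hcont).comp (Continuous.prodMk_right a)
    obtain ⟨D, hD⟩ : ∃ D, D = (|v a 0 ℓ - b| + 1) / c := ⟨_, rfl⟩
    have hD0 : 0 < D := by rw [hD]; positivity
    have hDc : D * c = |v a 0 ℓ - b| + 1 := by rw [hD]; field_simp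
    have h1 := hexp a 0 D hD0
    have h2 := hexp a (-D) 0 (by linarith)
    have h3 := abs_le.1 (le_refl |v a 0 ℓ - b|)
    obtain ⟨s, -, hsb⟩ := intermediate_value_Icc (by linarith : -D ≤ D) hca.continuousOn
      (show b ∈ Icc (v a (-D) ℓ) (v a D ℓ) from ⟨by linarith, by linarith⟩)
    exact ⟨s, hsb⟩
  choose σ hσ using hsurj
  have hσc : Continuous fun x : ℝ × ℝ => σ x.1 x.2 := by
    refine (LipschitzWith.of_dist_le_mul (K := ⟨(1 + E) / c, by positivity⟩) fun x y => ?_).continuous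
    have h1 := hexp' x.1 (σ x.1 x.2) (σ y.1 y.2)
    rw [hσ] at h1
    have h2 := hdist y.1 (σ y.1 y.2) x.1 (σ y.1 y.2)
    have h3 : |v y.1 (σ y.1 y.2) ℓ - v x.1 (σ y.1 y.2) ℓ| ≤ dist x y * E := by
      refine (le_max_left _ _).trans (h2.trans ?_)
      gcongr
      rw [Prod.dist_eq, dist_self, max_eq_left dist_nonneg, dist_comm]
      exact le_max_left _ _
    rw [hσ] at h3
    have h4 : |x.2 - y.2| ≤ dist x y := le_max_right _ _
    have h5 := _root_.abs_sub_le x.2 y.2 (v x.1 (σ y.1 y.2) ℓ)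
    change |σ x.1 x.2 - σ y.1 y.2| ≤ (1 + E) / c * dist x y
    rw [div_mul_eq_mul_div, le_div_iff₀ hc0]
    linarith
  refine ⟨fun x => v x.1 (σ x.1 x.2), fun x => p x.1 (σ x.1 x.2),
    fun x => ⟨hs _ _, hv0 _ _, hσ _ _⟩, by simpa only [hp0] using hσc, ?_⟩
  exact (continuous_snd.comp hcont).comp (continuous_fst.prodMk hσc)

end IsEdgeField

namespace Network

variable {I A : Type} [Fintype I] [Fintype A] [DecidableEq I]

theorem tgt_eq_of_mem_edges (N : Network I A) {i : I} {α : A} (h : α ∈ N.edges i)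
    (hs : N.src α ≠ i) : N.tgt α = i := by
  simpa [edges, hs] using h

/-- Solvability of the Kirchhoff problem on a network for bounded Lipschitz nonlinearities: the
vertex values are found by maximizing their sum among discrete subsolutions. -/
theorem exists_solution_of_isEdgeField (N : Network I A) {c : I → A → ℝ}
    (hc : ∀ i, ∀ α ∈ N.edges i, 0 ≤ c i α) {g : A → ℝ → ℝ → ℝ → ℝ} {K : A → NNReal} {B : A → ℝ}
    {M : ℝ} (hM : 0 ≤ M) (hg : ∀ α, IsEdgeField (g α) (K α) (B α) M) :
    ∃ v p : A → ℝ → ℝ, (∀ α, IsEdgeSol (g α) (N.ℓ α) (v α) (p α)) ∧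
      (∀ i, ∀ α ∈ N.edges i, ∀ β ∈ N.edges i, N.vval v i α = N.vval v i β) ∧
      (∀ i, ∑ α ∈ N.edges i, c i α * N.oderiv p i α = 0) ∧
      ∀ α, ∀ t ∈ Icc 0 (N.ℓ α), |v α t| ≤ M := by
  choose V P hVP hP0 hPℓ using fun α => (hg α).exists_dirichlet (N.ℓ_pos α)
  let e : (I → ℝ) → A → ℝ × ℝ := fun a α => (a (N.src α), a (N.tgt α))
  let q : (I → ℝ) → I → A → ℝ := fun a i α => N.oderiv (fun α => P α (e a α)) i α
  let k : (I → ℝ) → I → ℝ := fun a i => ∑ α ∈ N.edges i, c i α * q a i α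
  have hsol : ∀ a α, IsEdgeSol (g α) (N.ℓ α) (V α (e a α)) (P α (e a α)) :=
    fun a α => (hVP α (e a α)).1
  have hV0 : ∀ a α, V α (e a α) 0 = a (N.src α) := fun a α => (hVP α (e a α)).2.1
  have hVℓ : ∀ a α, V α (e a α) (N.ℓ α) = a (N.tgt α) := fun a α => (hVP α (e a α)).2.2
  have hqc : ∀ i α, Continuous fun a => q a i α := by
    intro i α
    have hec : Continuous fun a => e a α := by fun_prop
    by_cases h : N.src α = i
    · have : Continuous fun a => -P α (e a α) 0 := ((hP0 α).comp hec).neg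
      simpa [q, oderiv, h] using this
    · have : Continuous fun a => P α (e a α) (N.ℓ α) := (hPℓ α).comp hec
      simpa [q, oderiv, h] using this
  have hkc : ∀ i, Continuous fun a => k a i := fun i =>
    continuous_finsetSum _ fun α _ => continuous_const.mul (hqc i α)
  have hqanti : ∀ (a b : I → ℝ) i, a i = b i → (∀ j, a j ≤ b j) →
      ∀ α ∈ N.edges i, q b i α ≤ q a i α := by
    intro a b i hi hab α hα
    by_cases h : N.src α = i
    · have := (hg α).deriv_left_le (N.ℓ_pos α) (hsol a α) (hsol b α)
        (by rw [hV0, hV0, h, hi]) (by rw [hVℓ, hVℓ]; exact hab _)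
      simpa [q, oderiv, h] using this
    · have h' := N.tgt_eq_of_mem_edges hα h
      have := (hg α).le_deriv_right (N.ℓ_pos α) (hsol a α) (hsol b α)
        (by rw [hV0, hV0]; exact hab _) (by rw [hVℓ, hVℓ, h', hi])
      simpa [q, oderiv, h] using this
  have hqtop : ∀ (a : I → ℝ) i, a i = M → (∀ j, a j ≤ M) → ∀ α ∈ N.edges i, 0 ≤ q a i α := by
    intro a i hi ha α hα
    by_cases h : N.src α = i
    · have := (hg α).deriv_left_nonpos (N.ℓ_pos α) (hsol a α) (by rw [hV0, h, hi])
        (by rw [hVℓ]; exact ha _)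
      simpa [q, oderiv, h] using this
    · have h' := N.tgt_eq_of_mem_edges hα h
      have := (hg α).deriv_right_nonneg (N.ℓ_pos α) (hsol a α) (by rw [hV0]; exact ha _)
        (by rw [hVℓ, h', hi])
      simpa [q, oderiv, h] using this
  have hqbot : ∀ (a : I → ℝ) i, a i = -M → (∀ j, -M ≤ a j) →
      ∀ α ∈ N.edges i, q a i α ≤ 0 := by
    intro a i hi ha α hα
    by_cases h : N.src α = i
    · have := (hg α).deriv_left_nonneg (N.ℓ_pos α) (hsol a α) (by rw [hV0, h, hi])
        (by rw [hVℓ]; exact ha _)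
      simpa [q, oderiv, h] using this
    · have h' := N.tgt_eq_of_mem_edges hα h
      have := (hg α).deriv_right_nonpos (N.ℓ_pos α) (hsol a α) (by rw [hV0]; exact ha _)
        (by rw [hVℓ, h', hi])
      simpa [q, oderiv, h] using this
  let S : Set (I → ℝ) := Icc (fun _ => -M) (fun _ => M) ∩ {a | ∀ i, k a i ≤ 0}
  have hSc : IsCompact S := by
    refine isCompact_Icc.inter_right ?_
    rw [ofPred_forall]
    exact isClosed_iInter fun i => isClosed_le (hkc i) continuous_const
  have hSne : S.Nonempty := by
    refine ⟨fun _ => -M, ⟨le_rfl, fun _ => by linarith⟩, fun i => ?_⟩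
    exact Finset.sum_nonpos fun α hα => mul_nonpos_of_nonneg_of_nonpos (hc i α hα)
      (hqbot _ i rfl (fun _ => le_rfl) α hα)
  obtain ⟨a, ⟨⟨halo, hahi⟩, hak⟩, hmax⟩ := hSc.exists_isMaxOn hSne
    (f := fun a => ∑ i, a i) (by fun_prop)
  have hk0 : ∀ i, k a i = 0 := by
    intro i
    refine le_antisymm (hak i) ?_
    by_contra! hneg
    rcases (hahi i).lt_or_eq with hlt | heq
    · have hev : ∀ᶠ x in nhds (a i), k (Function.update a i x) i < 0 := by
        have hcu : Continuous fun x => k (Function.update a i x) i :=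
          (hkc i).comp (continuous_const.update i continuous_id)
        refine hcu.continuousAt.eventually_lt continuousAt_const ?_
        simpa using hneg
      obtain ⟨x, ⟨hxk, hxM⟩, hx⟩ :=
        (((hev.and (Iio_mem_nhds hlt)).filter_mono nhdsWithin_le_nhds).and
          (self_mem_nhdsWithin (a := a i) (s := Ioi (a i)))).exists
      have hle : ∀ j, a j ≤ Function.update a i x j :=
        le_update_self_iff.2 (le_of_lt hx)
      have hmem : Function.update a i x ∈ S := by
        refine ⟨⟨fun j => (halo j).trans (hle j), fun j => ?_⟩, fun j => ?_⟩
        · rcases eq_or_ne j i with rfl | hj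
          · simpa using le_of_lt hxM
          · simpa [hj] using hahi j
        · rcases eq_or_ne j i with rfl | hj
          · exact hxk.le
          · refine le_trans (Finset.sum_le_sum fun α hα => ?_) (hak j)
            exact mul_le_mul_of_nonneg_left (hqanti _ _ j (by simp [hj]) hle α hα) (hc j α hα)
      have h1 : ∑ j, Function.update a i x j ≤ ∑ j, a j := hmax hmem
      have h2 : ∑ j, a j < ∑ j, Function.update a i x j :=
        Finset.sum_lt_sum (fun j _ => hle j) ⟨i, Finset.mem_univ i, by simpa using hx⟩
      linarith
    · exact absurd (Finset.sum_nonneg fun α hα => mul_nonneg (hc i α hα)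
        (hqtop a i heq hahi α hα)) (not_le.2 hneg)
  have hval : ∀ i, ∀ α ∈ N.edges i, N.vval (fun α => V α (e a α)) i α = a i := by
    intro i α hα
    by_cases h : N.src α = i
    · simp [vval, h, hV0]
    · simp [vval, h, hVℓ, N.tgt_eq_of_mem_edges hα h]
  refine ⟨fun α => V α (e a α), fun α => P α (e a α), hsol a, fun i α hα β hβ => ?_, hk0,
    fun α => (hg α).abs_le_of_boundary (hsol a α) ?_ ?_⟩
  · rw [hval i α hα, hval i β hβ]
  · beta_reduce
    rw [hV0]
    exact abs_le.2 ⟨halo _, hahi _⟩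
  · beta_reduce
    rw [hVℓ]
    exact abs_le.2 ⟨halo _, hahi _⟩

end Network

namespace HasSecondDeriv

variable {v p p' : ℝ → ℝ} {a b C M p₀ : ℝ}

theorem deriv_le_of_quadratic_growth (h : HasSecondDeriv v p p' a b)
    (hv : ∀ t ∈ Icc a b, |v t| ≤ M) (hC : 0 ≤ C)
    (hp : ∀ t ∈ Icc a b, |p' t| ≤ C * (1 + p t ^ 2)) {ξ y : ℝ} (hξ : a ≤ ξ) (hξy : ξ ≤ y)
    (hy : y ≤ b) (hp₀ : 0 ≤ p₀) (hpξ : p ξ ≤ p₀) :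
    p y ≤ (1 + p₀ ^ 2) * Real.exp (4 * C * M) := by
  have hM : 0 ≤ M := (abs_nonneg _).trans (hv ξ ⟨hξ, hξy.trans hy⟩)
  rcases le_or_gt (p y) p₀ with hle | hlt
  · have h1 : 1 ≤ Real.exp (4 * C * M) := Real.one_le_exp (by positivity)
    have h2 : p₀ ≤ 1 + p₀ ^ 2 := by nlinarith [sq_nonneg (p₀ - 1)]
    have h3 : 0 ≤ 1 + p₀ ^ 2 := by positivity
    nlinarith
  obtain ⟨t₀, ht₀, hpt₀, hpos⟩ :=
    exists_last_eq hξy (h.mono hξ hy).continuousOn_deriv hpξ hlt.le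
  have hsub := h.mono (hξ.trans ht₀.1) hy
  have hd : ∀ t ∈ Icc t₀ y, HasDerivWithinAt (fun t => Real.log (1 + p t ^ 2) - 2 * C * v t)
      (2 * p t * p' t / (1 + p t ^ 2) - 2 * C * p t) (Icc t₀ y) t := by
    intro t ht
    have h1 : HasDerivWithinAt (fun t => 1 + p t ^ 2) (2 * p t * p' t) (Icc t₀ y) t := by
      refine (((hsub.snd t ht).fun_pow 2).const_add 1).congr_deriv ?_
      norm_num
    exact (h1.log (by positivity)).fun_sub ((hsub.fst t ht).const_mul (2 * C))
  have hanti : AntitoneOn (fun t => Real.log (1 + p t ^ 2) - 2 * C * v t) (Icc t₀ y) := by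
    refine antitoneOn_of_hasDerivWithinAt_nonpos (convex_Icc t₀ y)
      (fun t ht => (hd t ht).continuousWithinAt)
      (fun x hx => (hd x (interior_subset hx)).mono interior_subset) (fun x hx => ?_)
    have hx' := interior_subset hx
    have h1 : 0 ≤ p x := hp₀.trans (hpos x hx')
    have h2 := (le_abs_self _).trans (hp x ⟨(hξ.trans ht₀.1).trans hx'.1, hx'.2.trans hy⟩)
    have h3 : 0 < 1 + p x ^ 2 := by positivity
    rw [sub_nonpos, div_le_iff₀ h3]
    nlinarith
  have h1 := hanti (left_mem_Icc.2 ht₀.2) (right_mem_Icc.2 ht₀.2) ht₀.2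
  simp only [hpt₀] at h1
  have h2 := abs_le.1 (hv t₀ ⟨hξ.trans ht₀.1, ht₀.2.trans hy⟩)
  have h3 := abs_le.1 (hv y ⟨hξ.trans hξy, hy⟩)
  have h4 : Real.log (1 + p y ^ 2) ≤ Real.log (1 + p₀ ^ 2) + 4 * C * M := by nlinarith
  have h5 := Real.exp_le_exp.2 h4
  rw [Real.exp_add, Real.exp_log (by positivity), Real.exp_log (by positivity)] at h5
  nlinarith [sq_nonneg (p y - 1)]

/-- A Bernstein–Nagumo gradient bound for quadratic growth. -/
theorem abs_deriv_le_of_quadratic_growth (h : HasSecondDeriv v p p' a b) (hab : a < b)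
    (hv : ∀ t ∈ Icc a b, |v t| ≤ M) (hC : 0 ≤ C)
    (hp : ∀ t ∈ Icc a b, |p' t| ≤ C * (1 + p t ^ 2)) :
    ∀ y ∈ Icc a b, |p y| ≤ (1 + (2 * M / (b - a)) ^ 2) * Real.exp (4 * C * M) := by
  intro y hy
  have hba : 0 < b - a := sub_pos.2 hab
  have hM : 0 ≤ M := (abs_nonneg _).trans (hv y hy)
  obtain ⟨ξ, hξ, hξ'⟩ := exists_hasDerivAt_eq_slope v p hab h.continuousOn
    (fun x hx => (h.fst x (Ioo_subset_Icc_self hx)).hasDerivAt (Icc_mem_nhds hx.1 hx.2))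
  have hpξ : |p ξ| ≤ 2 * M / (b - a) := by
    rw [hξ', abs_div, abs_of_pos hba]
    have h1 := abs_sub (v b) (v a)
    have h2 := hv a (left_mem_Icc.2 hab.le)
    have h3 := hv b (right_mem_Icc.2 hab.le)
    gcongr
    linarith
  have h0 : 0 ≤ 2 * M / (b - a) := by positivity
  rw [abs_le] at hpξ
  have hv' : ∀ t ∈ Icc a b, |-v t| ≤ M := fun t ht => by rw [abs_neg]; exact hv t ht
  have hp' : ∀ t ∈ Icc a b, |-p' t| ≤ C * (1 + (-p t) ^ 2) := fun t ht => by
    rw [abs_neg, neg_sq]; exact hp t ht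
  rw [abs_le']
  rcases le_total ξ y with hle | hle
  · exact ⟨h.deriv_le_of_quadratic_growth hv hC hp hξ.1.le hle hy.2 h0 hpξ.2,
      h.neg.deriv_le_of_quadratic_growth hv' hC hp' hξ.1.le hle hy.2 h0 (by linarith)⟩
  · have hmaps : ∀ t ∈ Icc a b, a + b - t ∈ Icc a b :=
      fun t ht => ⟨by linarith [ht.2], by linarith [ht.1]⟩
    have h1 := h.neg.reflect.deriv_le_of_quadratic_growth (ξ := a + b - ξ) (y := a + b - y)
      (p₀ := 2 * M / (b - a)) (fun t ht => hv' _ (hmaps t ht)) hC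
      (fun t ht => by rw [neg_neg, ← neg_sq]; exact hp' _ (hmaps t ht))
      (by linarith [hξ.2]) (by linarith) (by linarith [hy.1]) h0 (by simpa using hpξ.2)
    have h2 := h.reflect.deriv_le_of_quadratic_growth (ξ := a + b - ξ) (y := a + b - y)
      (p₀ := 2 * M / (b - a)) (fun t ht => hv _ (hmaps t ht)) hC
      (fun t ht => by rw [neg_sq]; exact hp _ (hmaps t ht))
      (by linarith [hξ.2]) (by linarith) (by linarith [hy.1]) h0
      (by rw [sub_sub_cancel]; linarith)
    simp only [sub_sub_cancel, neg_neg] at h1 h2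
    exact ⟨h1, h2⟩

end HasSecondDeriv

/-- Pointwise limits of functions whose derivatives converge pointwise and are asymptotically
uniformly equicontinuous. -/
theorem hasDerivWithinAt_of_tendsto {ι : Type*} {l : Filter ι} [l.NeBot] {f f' : ι → ℝ → ℝ}
    {F F' : ℝ → ℝ} {a b : ℝ}
    (hd : ∀ n, ∀ t ∈ Icc a b, HasDerivWithinAt (f n) (f' n t) (Icc a b) t)
    (hf : ∀ t ∈ Icc a b, Filter.Tendsto (fun n => f n t) l (nhds (F t)))
    (hf' : ∀ t ∈ Icc a b, Filter.Tendsto (fun n => f' n t) l (nhds (F' t)))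
    (heq : ∀ ε > 0, ∃ δ > 0, ∀ᶠ n in l, ∀ s ∈ Icc a b, ∀ t ∈ Icc a b, |t - s| < δ →
      |f' n t - f' n s| ≤ ε) :
    ∀ s ∈ Icc a b, HasDerivWithinAt F (F' s) (Icc a b) s := by
  intro s hs
  rw [hasDerivWithinAt_iff_isLittleO, Asymptotics.isLittleO_iff]
  intro ε hε
  obtain ⟨δ, hδ, hev⟩ := heq ε hε
  filter_upwards [self_mem_nhdsWithin, mem_nhdsWithin_of_mem_nhds (Metric.ball_mem_nhds s hδ)]
    with t ht htδ
  rw [Metric.mem_ball, Real.dist_eq] at htδ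
  have hle : ∀ᶠ n in l, ‖f n t - f n s - (t - s) • f' n s‖ ≤ ε * ‖t - s‖ := by
    filter_upwards [hev] with n hn
    have hsub : uIcc s t ⊆ Icc a b := (ordConnected_Icc.uIcc_subset hs ht)
    have hder : ∀ x ∈ uIcc s t, HasDerivWithinAt (fun x => f n x - x * f' n s)
        (f' n x - 1 * f' n s) (uIcc s t) x := fun x hx =>
      ((hd n x (hsub hx)).mono hsub).fun_sub ((hasDerivWithinAt_id x _).mul_const _)
    have := (convex_uIcc s t).norm_image_sub_le_of_norm_hasDerivWithin_le hder (C := ε)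
      (fun x hx => by
        rw [one_mul]
        refine hn s hs x (hsub hx) ?_
        exact (abs_sub_left_of_mem_uIcc hx).trans_lt htδ) left_mem_uIcc right_mem_uIcc
    refine le_of_eq_of_le (congrArg _ ?_) this
    rw [smul_eq_mul]
    ring
  refine le_of_tendsto ?_ hle
  exact (((hf t ht).sub (hf s hs)).sub ((hf' s hs).const_smul (t - s))).norm

/-- Uniform approximation of a continuous Hamiltonian on a compact rectangle by Hamiltonians that
are Lipschitz in the momentum and bounded. -/
theorem exists_lipschitz_approx {h : ℝ → ℝ → ℝ} {ℓ R ε : ℝ} (hℓ : 0 ≤ ℓ) (hR : 0 ≤ R)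
    (hε : 0 < ε) (hc : ContinuousOn (fun z : ℝ × ℝ => h z.1 z.2) (Icc 0 ℓ ×ˢ univ)) :
    ∃ (k : ℝ → ℝ → ℝ) (L : NNReal), (∀ p, Continuous fun t => k t p) ∧
      (∀ t, LipschitzWith L (k t)) ∧
      ∀ t p, |k t p - h (projIcc 0 ℓ hℓ t) (projIcc (-R) R (by linarith) p)| ≤ ε := by
  have hR' : -R ≤ R := by linarith
  let π : ℝ × ℝ → ℝ × ℝ := fun z => (projIcc 0 ℓ hℓ z.1, projIcc (-R) R hR' z.2)
  have hπ : Continuous π := by fun_prop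
  have hhc : Continuous fun z => h (π z).1 (π z).2 :=
    hc.comp_continuous hπ fun z => ⟨(projIcc 0 ℓ hℓ z.1).2, mem_univ _⟩
  obtain ⟨k, hk, hkε, -⟩ := hhc.exists_contDiff_approx 1 (continuous_const (y := ε)) fun _ => hε
  obtain ⟨L, hL⟩ := hk.contDiffOn.exists_lipschitzOnWith one_ne_zero
    ((convex_Icc (0 : ℝ) ℓ).prod (convex_Icc (-R) R)) (isCompact_Icc.prod isCompact_Icc)
  have hππ : ∀ z, π (π z) = π z := fun z => by simp [π]
  refine ⟨fun t p => k (π (t, p)), L, fun p => by fun_prop, fun t => ?_, fun t p => ?_⟩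
  · refine LipschitzWith.of_dist_le_mul fun p q => ?_
    refine (hL.dist_le_mul (π (t, p)) ⟨Subtype.prop _, Subtype.prop _⟩ (π (t, q))
      ⟨Subtype.prop _, Subtype.prop _⟩).trans ?_
    gcongr
    rw [Prod.dist_eq]
    simp only [π, dist_self]
    exact max_le dist_nonneg (by
      simpa [Subtype.dist_eq] using (LipschitzWith.projIcc hR').dist_le_mul p q)
  · have := (hkε (π (t, p))).le
    rwa [hππ, Real.dist_eq] at this

theorem abs_coe_projIcc_le {R : ℝ} (hR : -R ≤ R) (p : ℝ) : |(projIcc (-R) R hR p : ℝ)| ≤ |p| := by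
  have hR0 : 0 ≤ R := by linarith
  have h0 : projIcc (-R) R hR 0 = ⟨0, by linarith, hR0⟩ := projIcc_of_mem hR ⟨by linarith, hR0⟩
  simpa [Subtype.dist_eq, h0] using (LipschitzWith.projIcc hR).dist_le_mul p 0

theorem HasSecondDeriv.of_tendsto {ι : Type*} {l : Filter ι} [l.NeBot] {h : ℝ → ℝ → ℝ}
    {m lam ℓ R B : ℝ} (hm : 0 < m) (hlam : 0 ≤ lam)
    (hc : ContinuousOn (fun z : ℝ × ℝ => h z.1 z.2) (Icc 0 ℓ ×ˢ univ))
    {v p G : ι → ℝ → ℝ} {ε : ι → ℝ} (hε : Filter.Tendsto ε l (nhds 0))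
    (hs : ∀ n, HasSecondDeriv (v n) (p n) (G n) 0 ℓ) (hp : ∀ n, ∀ t ∈ Icc 0 ℓ, |p n t| ≤ R)
    (hG : ∀ n, ∀ t ∈ Icc 0 ℓ, |G n t| ≤ B)
    (happ : ∀ n, ∀ t ∈ Icc 0 ℓ, |G n t - (h t (p n t) + lam * v n t) / m| ≤ ε n)
    {V P : ℝ → ℝ} (hV : ∀ t ∈ Icc 0 ℓ, Filter.Tendsto (fun n => v n t) l (nhds (V t)))
    (hP : ∀ t ∈ Icc 0 ℓ, Filter.Tendsto (fun n => p n t) l (nhds (P t))) :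
    HasSecondDeriv V P (fun t => (h t (P t) + lam * V t) / m) 0 ℓ := by
  rcases (Icc 0 ℓ).eq_empty_or_nonempty with he | ⟨x₀, hx₀⟩
  · exact ⟨fun t ht => by simp [he] at ht, fun t ht => by simp [he] at ht⟩
  obtain ⟨n₀⟩ := l.nonempty_of_neBot
  have hR : 0 ≤ R := (abs_nonneg _).trans (hp n₀ x₀ hx₀)
  have hB : 0 ≤ B := (abs_nonneg _).trans (hG n₀ x₀ hx₀)
  have hplip : ∀ n, ∀ s ∈ Icc 0 ℓ, ∀ t ∈ Icc 0 ℓ, |p n t - p n s| ≤ B * |t - s| :=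
    fun n s hs' t ht => (convex_Icc 0 ℓ).norm_image_sub_le_of_norm_hasDerivWithin_le
      (hs n).snd (hG n) hs' ht
  have hvlip : ∀ n, ∀ s ∈ Icc 0 ℓ, ∀ t ∈ Icc 0 ℓ, |v n t - v n s| ≤ R * |t - s| :=
    fun n s hs' t ht => (convex_Icc 0 ℓ).norm_image_sub_le_of_norm_hasDerivWithin_le
      (hs n).fst (hp n) hs' ht
  refine ⟨hasDerivWithinAt_of_tendsto (fun n => (hs n).fst) hV hP fun η hη => ?_,
    hasDerivWithinAt_of_tendsto (fun n => (hs n).snd) hP (fun t ht => ?_) fun η hη => ?_⟩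
  · refine ⟨η / (B + 1), by positivity, Filter.Eventually.of_forall fun n s hs' t ht hst => ?_⟩
    rw [lt_div_iff₀ (by positivity)] at hst
    have := hplip n s hs' t ht
    nlinarith [abs_nonneg (t - s)]
  · have h1 : Filter.Tendsto (fun n => h t (p n t)) l (nhds (h t (P t))) := by
      have hct : Continuous fun q => h t q :=
        hc.comp_continuous (Continuous.prodMk_right t) fun q => ⟨ht, mem_univ _⟩
      exact (hct.tendsto (P t)).comp (hP t ht)
    have h2 := (h1.add ((hV t ht).const_mul lam)).div_const m
    have h3 : Filter.Tendsto (fun n => G n t - (h t (p n t) + lam * v n t) / m) l (nhds 0) :=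
      squeeze_zero_norm (fun n => happ n t ht) hε
    simpa using h3.add h2
  · have huc : UniformContinuousOn (fun z : ℝ × ℝ => h z.1 z.2) (Icc 0 ℓ ×ˢ Icc (-R) R) :=
      (isCompact_Icc.prod isCompact_Icc).uniformContinuousOn_of_continuous
        (hc.mono (prod_mono_right (subset_univ _)))
    obtain ⟨δ, hδ, hδH⟩ := Metric.uniformContinuousOn_iff.1 huc (m * (η / 4)) (by positivity)
    refine ⟨min (δ / (B + 1)) (m * (η / 4) / (lam * R + 1)), by positivity, ?_⟩
    filter_upwards [hε.eventually_le_const (show 0 < η / 4 by positivity)]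
      with n hn s hs' t ht hst
    obtain ⟨hst₁, hst₂⟩ := lt_min_iff.1 hst
    rw [lt_div_iff₀ (by positivity)] at hst₁ hst₂
    have h0 := abs_nonneg (t - s)
    have hH : |h t (p n t) - h s (p n s)| < m * (η / 4) := by
      refine hδH (t, p n t) ⟨ht, abs_le.1 (hp n t ht)⟩ (s, p n s) ⟨hs', abs_le.1 (hp n s hs')⟩ ?_
      rw [Prod.dist_eq]
      refine max_lt ?_ ((hplip n s hs' t ht).trans_lt (by linarith))
      rw [Real.dist_eq]
      nlinarith
    have hv : |lam * (v n t - v n s)| ≤ m * (η / 4) := by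
      rw [abs_mul, abs_of_nonneg hlam]
      have := mul_le_mul_of_nonneg_left (hvlip n s hs' t ht) hlam
      linarith
    have hq : |(h t (p n t) + lam * v n t) / m - (h s (p n s) + lam * v n s) / m| ≤ η / 2 := by
      rw [← sub_div, abs_div, abs_of_pos hm, div_le_iff₀ hm]
      have := abs_add_le (h t (p n t) - h s (p n s)) (lam * (v n t - v n s))
      rw [show h t (p n t) + lam * v n t - (h s (p n s) + lam * v n s) =
        h t (p n t) - h s (p n s) + lam * (v n t - v n s) by ring]
      linarith
    have ht' := abs_le.1 ((happ n t ht).trans hn)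
    have hs'' := abs_le.1 ((happ n s hs').trans hn)
    have hq' := abs_le.1 hq
    rw [abs_le]
    constructor <;> linarith

namespace Network

variable {I A : Type} [Fintype I] [Fintype A] [DecidableEq I]

theorem exists_solution (N : Network I A) {μ : A → ℝ} {γ : I → A → ℝ}
    (hμ : ∀ α, 0 < μ α) (hγ : ∀ i : I, ∀ α ∈ N.edges i, 0 < γ i α)
    {lam C₂ : ℝ} (hlam : 0 < lam) (hC₂ : 0 < C₂) {H : A → ℝ → ℝ → ℝ}
    (hHcont : ∀ α, ContinuousOn (fun z : ℝ × ℝ => H α z.1 z.2)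
      (Icc (0:ℝ) (N.ℓ α) ×ˢ (univ : Set ℝ)))
    (hHgrowth : ∀ α, ∀ x ∈ Icc (0:ℝ) (N.ℓ α), ∀ p : ℝ, |H α x p| ≤ C₂ * (1 + p ^ 2)) :
    ∃ v p : A → ℝ → ℝ,
      IsC2 N v p (fun α y => (H α y (p α y) + lam * v α y) / μ α) ∧ Kirchhoff N μ γ p := by
  have hℓ : ∀ α, 0 ≤ N.ℓ α := fun α => (N.ℓ_pos α).le
  obtain ⟨M, hM⟩ : ∃ M, M = (C₂ + 1) / lam := ⟨_, rfl⟩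
  have hM0 : 0 ≤ M := by rw [hM]; positivity
  have hMM : -M ≤ M := by linarith
  have hlamM : lam * M = C₂ + 1 := by rw [hM]; field_simp
  obtain ⟨C, hC⟩ : ∃ C : A → ℝ, ∀ α, C α = 2 * (C₂ + 1) / μ α := ⟨_, fun _ => rfl⟩
  have hC0 : ∀ α, 0 ≤ C α := fun α => by rw [hC]; have := hμ α; positivity
  obtain ⟨R, hR⟩ : ∃ R : A → ℝ, ∀ α, R α =
    (1 + (2 * M / (N.ℓ α - 0)) ^ 2) * Real.exp (4 * C α * M) := ⟨_, fun _ => rfl⟩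
  have hR0 : ∀ α, 0 ≤ R α := fun α => by rw [hR]; positivity
  have hRR : ∀ α, -R α ≤ R α := fun α => by linarith [hR0 α]
  choose k L hkc hkL hk using fun (n : ℕ) (α : A) =>
    exists_lipschitz_approx (hℓ α) (hR0 α) (Nat.one_div_pos_of_nat (α := ℝ) (n := n)) (hHcont α)
  have hε1 : ∀ n : ℕ, 1 / ((n : ℝ) + 1) ≤ 1 := fun n => by
    rw [div_le_one (by positivity)]
    linarith [n.cast_nonneg (α := ℝ)]
  have hkproj : ∀ n α t p, |k n α t p| ≤ (C₂ + 1) * (1 + (projIcc (-R α) (R α) (hRR α) p : ℝ) ^ 2) :=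
    fun n α t p => by
      have h1 := hHgrowth α _ (projIcc 0 (N.ℓ α) (hℓ α) t).2 (projIcc (-R α) (R α) (hRR α) p)
      have h2 := abs_sub_abs_le_abs_sub (k n α t p) _ |>.trans ((hk n α t p).trans (hε1 n))
      nlinarith [sq_nonneg (projIcc (-R α) (R α) (hRR α) p : ℝ)]
  have hkgrowth : ∀ n α t p, |k n α t p| ≤ (C₂ + 1) * (1 + p ^ 2) := fun n α t p => by
    refine (hkproj n α t p).trans ?_
    have := sq_le_sq.2 (abs_coe_projIcc_le (hRR α) p)
    gcongr
  have hkbdd : ∀ n α t p, |k n α t p| ≤ (C₂ + 1) * (1 + R α ^ 2) := fun n α t p => by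
    refine (hkproj n α t p).trans ?_
    have : (projIcc (-R α) (R α) (hRR α) p : ℝ) ^ 2 ≤ R α ^ 2 :=
      sq_le_sq' (projIcc (-R α) (R α) (hRR α) p).2.1 (projIcc (-R α) (R α) (hRR α) p).2.2
    gcongr
  have hcl : ∀ x, lam * |(projIcc (-M) M hMM x : ℝ)| ≤ C₂ + 1 := fun x => by
    rw [← hlamM]
    exact mul_le_mul_of_nonneg_left (abs_le.2 (projIcc (-M) M hMM x).2) hlam.le
  let g : ℕ → A → ℝ → ℝ → ℝ → ℝ := fun n α t x p =>
    (k n α t p + lam * projIcc (-M) M hMM x) / μ α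
  have hgle : ∀ n α t x p D, |k n α t p| ≤ (C₂ + 1) * (1 + D) → 0 ≤ D →
      |g n α t x p| ≤ C α * (1 + D) := fun n α t x p D hD hD0 => by
    have h1 := abs_add_le (k n α t p) (lam * projIcc (-M) M hMM x)
    rw [abs_mul, abs_of_pos hlam] at h1
    have h2 := hcl x
    rw [hC, abs_div, abs_of_pos (hμ α), div_mul_eq_mul_div]
    refine div_le_div_of_nonneg_right ?_ (hμ α).le
    nlinarith
  have hg : ∀ n α, IsEdgeField (g n α) (Real.toNNReal ((L n α + lam) / μ α))
      (C α * (1 + R α ^ 2)) M := fun n α => by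
    have hμα := hμ α
    refine ⟨fun x p => ?_, fun t => LipschitzWith.of_dist_le_mul fun z z' => ?_,
      fun t p x y hxy => ?_, fun t x p => hgle n α t x p _ (hkbdd n α t p) (sq_nonneg _),
      fun t => ?_, fun t => ?_⟩
    · exact ((hkc n α p).add continuous_const).div_const _
    · have h1 : |k n α t z.2 - k n α t z'.2| ≤ L n α * dist z z' :=
        ((hkL n α t).dist_le_mul _ _).trans
          (mul_le_mul_of_nonneg_left (le_max_right _ _) (L n α).2)
      have h2 : |(projIcc (-M) M hMM z.1 : ℝ) - projIcc (-M) M hMM z'.1| ≤ dist z z' := by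
        have := (LipschitzWith.projIcc hMM).dist_le_mul z.1 z'.1
        rw [NNReal.coe_one, one_mul] at this
        exact this.trans (le_max_left _ _)
      rw [Real.coe_toNNReal _ (by positivity), Real.dist_eq, ← sub_div, abs_div, abs_of_pos hμα,
        div_mul_eq_mul_div]
      refine div_le_div_of_nonneg_right ?_ hμα.le
      have h3 := abs_add_le (k n α t z.2 - k n α t z'.2)
        (lam * ((projIcc (-M) M hMM z.1 : ℝ) - projIcc (-M) M hMM z'.1))
      rw [abs_mul, abs_of_pos hlam] at h3
      have h4 := mul_le_mul_of_nonneg_left h2 hlam.le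
      refine le_trans (le_of_eq (congrArg _ ?_)) (h3.trans ?_)
      · ring
      · linarith
    · refine div_le_div_of_nonneg_right ?_ hμα.le
      have : (projIcc (-M) M hMM x : ℝ) ≤ projIcc (-M) M hMM y := monotone_projIcc hMM hxy
      gcongr
    · have := abs_le.1 (hkgrowth n α t 0)
      refine div_nonneg ?_ hμα.le
      rw [projIcc_right, hlamM]
      linarith
    · have := abs_le.1 (hkgrowth n α t 0)
      refine div_nonpos_of_nonpos_of_nonneg ?_ hμα.le
      rw [projIcc_left]
      linarith
  choose v p hsol hval hkir hvM using fun n => N.exists_solution_of_isEdgeField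
    (c := fun i α => γ i α * μ α) (fun i α hα => (mul_pos (hγ i α hα) (hμ α)).le) hM0 (hg n)
  have hpR : ∀ n α, ∀ t ∈ Icc 0 (N.ℓ α), |p n α t| ≤ R α := fun n α => by
    rw [hR]
    exact HasSecondDeriv.abs_deriv_le_of_quadratic_growth (hsol n α) (N.ℓ_pos α) (hvM n α)
      (hC0 α) fun t _ => hgle n α t _ _ _ (hkgrowth n α t _) (sq_nonneg _)
  let l : Ultrafilter ℕ := Filter.hyperfilter ℕ
  have hlim : ∀ {r : ℝ} {f : ℕ → ℝ}, (∀ n, |f n| ≤ r) →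
      ∃ x, Filter.Tendsto f l (nhds x) := fun {r f} hf => by
    obtain ⟨x, -, hx⟩ := (isCompact_Icc (a := -r) (b := r)).ultrafilter_le_nhds (l.map f)
      (Filter.tendsto_principal.2 (Filter.Eventually.of_forall fun n => abs_le.1 (hf n)))
    exact ⟨x, hx⟩
  have hVex : ∀ α t, ∃ x, t ∈ Icc 0 (N.ℓ α) → Filter.Tendsto (fun n => v n α t) l (nhds x) :=
    fun α t => by
      by_cases ht : t ∈ Icc 0 (N.ℓ α)
      · obtain ⟨x, hx⟩ := hlim fun n => hvM n α t ht
        exact ⟨x, fun _ => hx⟩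
      · exact ⟨0, fun h => absurd h ht⟩
  have hPex : ∀ α t, ∃ x, t ∈ Icc 0 (N.ℓ α) → Filter.Tendsto (fun n => p n α t) l (nhds x) :=
    fun α t => by
      by_cases ht : t ∈ Icc 0 (N.ℓ α)
      · obtain ⟨x, hx⟩ := hlim fun n => hpR n α t ht
        exact ⟨x, fun _ => hx⟩
      · exact ⟨0, fun h => absurd h ht⟩
  choose V hV using hVex
  choose P hP using hPex
  have h0 : ∀ α, (0 : ℝ) ∈ Icc 0 (N.ℓ α) := fun α => left_mem_Icc.2 (hℓ α)
  have h1 : ∀ α, N.ℓ α ∈ Icc 0 (N.ℓ α) := fun α => right_mem_Icc.2 (hℓ α)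
  have hsd : ∀ α, HasSecondDeriv (V α) (P α)
      (fun y => (H α y (P α y) + lam * V α y) / μ α) 0 (N.ℓ α) := fun α => by
    have hε : Filter.Tendsto (fun n : ℕ => 1 / ((n : ℝ) + 1) / μ α) l (nhds 0) := by
      have := (tendsto_one_div_add_atTop_nhds_zero_nat (𝕜 := ℝ)).div_const (μ α)
      rw [zero_div] at this
      exact this.mono_left Nat.hyperfilter_le_atTop
    refine HasSecondDeriv.of_tendsto (hμ α) hlam.le (hHcont α) hε (fun n => hsol n α)
      (fun n => hpR n α) (fun n t _ => (hg n α).bdd t _ _) (fun n t ht => ?_) (hV α) (hP α)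
    have h2 := hk n α t (p n α t)
    rw [projIcc_of_mem (hℓ α) ht, projIcc_of_mem (hRR α) (abs_le.1 (hpR n α t ht))] at h2
    simp only [g]
    rw [projIcc_of_mem hMM (abs_le.1 (hvM n α t ht)), ← sub_div, abs_div, abs_of_pos (hμ α)]
    refine div_le_div_of_nonneg_right ?_ (hμ α).le
    simpa using h2
  refine ⟨V, P, ⟨fun α => (hsd α).fst, fun α => (hsd α).snd, fun α => ?_, fun i α hα β hβ => ?_⟩,
    fun i => ?_⟩
  · have h2 : ContinuousOn (fun y => H α y (P α y)) (Icc 0 (N.ℓ α)) :=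
      (hHcont α).comp (continuousOn_id.prodMk (hsd α).continuousOn_deriv)
        fun y hy => ⟨hy, mem_univ _⟩
    exact (h2.add (continuousOn_const.mul (hsd α).continuousOn)).div_const _
  · have hvv : ∀ α, Filter.Tendsto (fun n => N.vval (v n) i α) l (nhds (N.vval V i α)) :=
      fun α => by
        unfold vval
        split_ifs
        · exact hV α 0 (h0 α)
        · exact hV α _ (h1 α)
    exact tendsto_nhds_unique (hvv α) ((hvv β).congr fun n => (hval n i α hα β hβ).symm)
  · have hod : ∀ α, Filter.Tendsto (fun n => N.oderiv (p n) i α) l (nhds (N.oderiv P i α)) :=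
      fun α => by
        unfold oderiv
        split_ifs
        · exact (hP α 0 (h0 α)).neg
        · exact hP α _ (h1 α)
    have hsum : Filter.Tendsto (fun n => ∑ α ∈ N.edges i, γ i α * μ α * N.oderiv (p n) i α) l
        (nhds (∑ α ∈ N.edges i, γ i α * μ α * N.oderiv P i α)) :=
      tendsto_finsetSum _ fun α _ => (hod α).const_mul _
    exact tendsto_nhds_unique hsum (tendsto_const_nhds.congr fun n => (hkir n i).symm)

theorem IsC2.exists_lipschitzOnWith {N : Network I A} {v p w : A → ℝ → ℝ}
    (h : N.IsC2 v p w) (α : A) :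
    (∃ K, LipschitzOnWith K (v α) (Icc 0 (N.ℓ α))) ∧
      ∃ K, LipschitzOnWith K (p α) (Icc 0 (N.ℓ α)) := by
  obtain ⟨hv, hp, hw, -⟩ := h
  have aux : ∀ {f f' : ℝ → ℝ}, (∀ y ∈ Icc 0 (N.ℓ α), HasDerivWithinAt f (f' y)
      (Icc 0 (N.ℓ α)) y) → ContinuousOn f' (Icc 0 (N.ℓ α)) →
      ∃ K, LipschitzOnWith K f (Icc 0 (N.ℓ α)) := fun {f f'} hf hf' => by
    obtain ⟨C, hC⟩ := isCompact_Icc.exists_bound_of_continuousOn hf'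
    refine ⟨Real.toNNReal C, (convex_Icc 0 (N.ℓ α)).lipschitzOnWith_of_nnnorm_hasDerivWithin_le hf
      fun y hy => ?_⟩
    rw [← NNReal.coe_le_coe, coe_nnnorm]
    exact (hC y hy).trans (Real.le_coe_toNNReal C)
  exact ⟨aux (hv α) fun y hy => (hp α y hy).continuousWithinAt, aux (hp α) (hw α)⟩

end Network

/-- existence of a classical solution of the HJB boundary value problem
for a continuous Hamiltonian with quadratic growth `|H_α(x,p)| ≤ C₂(1 + p²)`; if moreover
each `H_α` is locally Lipschitz, the solution can be taken with `v''_α` Lipschitz. -/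
theorem stmt_10 {I A : Type} [Fintype I] [Fintype A] [DecidableEq I]
    (N : Network I A) (μ : A → ℝ) (γ : I → A → ℝ)
    (hμ : ∀ α, 0 < μ α) (hγ : ∀ i : I, ∀ α ∈ N.edges i, 0 < γ i α)
    (lam C₂ : ℝ) (hlam : 0 < lam) (hC₂ : 0 < C₂)
    (H : A → ℝ → ℝ → ℝ)
    (hHcont : ∀ α, ContinuousOn (fun z : ℝ × ℝ => H α z.1 z.2)
      (Icc (0:ℝ) (N.ℓ α) ×ˢ (univ : Set ℝ)))
    (hHgrowth : ∀ α, ∀ x ∈ Icc (0:ℝ) (N.ℓ α), ∀ p : ℝ, |H α x p| ≤ C₂ * (1 + p ^ 2)) :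
    (∃ v v' v'' : A → ℝ → ℝ,
      Network.IsC2 N v v' v'' ∧
      (∀ α : A, ∀ y ∈ Ioo (0:ℝ) (N.ℓ α),
        -(μ α * v'' α y) + H α y (v' α y) + lam * v α y = 0) ∧
      Network.Kirchhoff N μ γ v') ∧
    ((∀ α : A, ∀ R : ℝ, ∃ K : NNReal, LipschitzOnWith K
        (fun z : ℝ × ℝ => H α z.1 z.2) (Icc (0:ℝ) (N.ℓ α) ×ˢ Icc (-R) R)) →
      ∃ v v' v'' : A → ℝ → ℝ,
        Network.IsC2 N v v' v'' ∧
        (∀ α : A, ∀ y ∈ Ioo (0:ℝ) (N.ℓ α),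
          -(μ α * v'' α y) + H α y (v' α y) + lam * v α y = 0) ∧
        Network.Kirchhoff N μ γ v' ∧
        (∀ α : A, ∃ K : NNReal, LipschitzOnWith K (v'' α) (Icc (0:ℝ) (N.ℓ α)))) := by
  obtain ⟨v, p, hC2, hK⟩ := N.exists_solution hμ hγ hlam hC₂ hHcont hHgrowth
  have heq : ∀ α : A, ∀ y ∈ Ioo (0:ℝ) (N.ℓ α),
      -(μ α * ((H α y (p α y) + lam * v α y) / μ α)) + H α y (p α y) + lam * v α y = 0 :=
    fun α y _ => by
      rw [mul_div_cancel₀ _ (hμ α).ne']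
      ring
  refine ⟨⟨v, p, _, hC2, heq, hK⟩, fun hlip => ⟨v, p, _, hC2, heq, hK, fun α => ?_⟩⟩
  obtain ⟨⟨Kv, hKv⟩, Kp, hKp⟩ := hC2.exists_lipschitzOnWith α
  obtain ⟨R, hR⟩ := isCompact_Icc.exists_bound_of_continuousOn hKp.continuousOn
  obtain ⟨KH, hKH⟩ := hlip α R
  have hcomp : LipschitzOnWith (KH * max 1 Kp) (fun y => H α y (p α y)) (Icc 0 (N.ℓ α)) :=
    hKH.comp (LipschitzWith.id.lipschitzOnWith.prodMk hKp) fun y hy => ⟨hy, abs_le.1 (hR y hy)⟩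
  have hsum := hcomp.add ((lipschitzWith_smul lam).comp_lipschitzOnWith hKv)
  have hdiv := (lipschitzWith_smul (μ α)⁻¹).comp_lipschitzOnWith hsum
  simp only [div_eq_inv_mul]
  exact ⟨_, hdiv⟩
end

section
/- Let Γ be a connected network and let u be a function on Γ such that u_α ∈ C¹([0, ℓ_α]) for every α ∈ 𝒜, u is continuous at the vertices, and u_β(y₀) = 0 for some β ∈ 𝒜 and some y₀ ∈ [0, ℓ_β]. Then sup_{α∈𝒜} max_{y∈[0,ℓ_α]} |u_α(y)| ≤ ∑_{α∈𝒜} ∫_0^{ℓ_α} |u_α'(y)| dy. -/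
open Set

open MeasureTheory in
/-- The image of an interval under a `C¹` function has length at most the integral of the
absolute value of the derivative. -/
theorem volume_image_Icc_le_integral_abs_deriv {f f' : ℝ → ℝ} {a b : ℝ} (hab : a ≤ b)
    (hd : ∀ y ∈ Icc a b, HasDerivWithinAt f (f' y) (Icc a b) y)
    (hc : ContinuousOn f' (Icc a b)) :
    volume (f '' Icc a b) ≤ ENNReal.ofReal (∫ y in a..b, |f' y|) := by
  have hint : IntegrableOn (fun y => |f' y|) (Icc a b) := hc.abs.integrableOn_Icc
  have h := addHaar_image_le_lintegral_abs_det_fderiv volume measurableSet_Icc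
    fun y hy => (hd y hy).hasFDerivWithinAt
  rw [intervalIntegral.integral_of_le hab, ← integral_Icc_eq_integral_Ioc,
    ofReal_integral_eq_lintegral_ofReal hint (ae_of_all _ fun _ => abs_nonneg _)]
  simpa using h

namespace Network

variable {I A : Type} [Fintype I] [Fintype A] [DecidableEq I]

theorem mem_edges (N : Network I A) {i : I} {α : A} :
    α ∈ N.edges i ↔ N.src α = i ∨ N.tgt α = i := by
  simp [edges]

/-- The value at a vertex along an edge is attained on that edge. -/
theorem vval_mem_image (N : Network I A) (f : A → ℝ → ℝ) (i : I) (α : A) :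
    N.vval f i α ∈ f α '' Icc 0 (N.ℓ α) := by
  have h := (N.ℓ_pos α).le
  unfold vval
  split_ifs
  · exact mem_image_of_mem _ (left_mem_Icc.2 h)
  · exact mem_image_of_mem _ (right_mem_Icc.2 h)

/-- Any two edges of a network are joined by a chain of edges in which consecutive edges
share a vertex. -/
theorem reflTransGen_edges (N : Network I A) (α β : A) :
    Relation.ReflTransGen (fun α β => ∃ i, α ∈ N.edges i ∧ β ∈ N.edges i) α β := by
  suffices ∀ j, ∀ β ∈ N.edges j,
      Relation.ReflTransGen (fun α β => ∃ i, α ∈ N.edges i ∧ β ∈ N.edges i) α β from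
    this (N.src β) β (N.mem_edges.2 (Or.inl rfl))
  intro j
  induction N.connected (N.src α) j with
  | refl => exact fun β hβ => .single ⟨_, N.mem_edges.2 (Or.inl rfl), hβ⟩
  | @tail i j _ hij ih =>
    obtain ⟨γ, hγ⟩ := hij
    have hi : γ ∈ N.edges i := N.mem_edges.2 (by tauto)
    have hj : γ ∈ N.edges j := N.mem_edges.2 (by tauto)
    exact fun β hβ => (ih γ hi).tail ⟨j, hj, hβ⟩

/-- The range of a function on a network that is continuous on the edges and at the vertices
is connected. -/
theorem isPreconnected_iUnion_image (N : Network I A) {u : A → ℝ → ℝ}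
    (hu : ∀ α, ContinuousOn (u α) (Icc 0 (N.ℓ α)))
    (hvert : ∀ i : I, ∀ α ∈ N.edges i, ∀ β ∈ N.edges i, N.vval u i α = N.vval u i β) :
    IsPreconnected (⋃ α, u α '' Icc 0 (N.ℓ α)) := by
  refine IsPreconnected.iUnion_of_reflTransGen (fun α => isPreconnected_Icc.image _ (hu α)) ?_
  refine fun α β => Relation.ReflTransGen.mono ?_ _ _ (N.reflTransGen_edges α β)
  rintro α β ⟨i, hα, hβ⟩
  exact ⟨_, N.vval_mem_image u i α, hvert i α hα β hβ ▸ N.vval_mem_image u i β⟩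

end Network

/-- a Poincaré-type inequality on the network: a `C¹` function which is
continuous at the vertices and vanishes somewhere is bounded by the total integral of the
absolute value of its derivative. -/
theorem stmt_13 {I A : Type} [Fintype I] [Fintype A] [DecidableEq I]
    (N : Network I A)
    (u u' : A → ℝ → ℝ)
    (hd : ∀ α, ∀ y ∈ Icc (0:ℝ) (N.ℓ α), HasDerivWithinAt (u α) (u' α y) (Icc 0 (N.ℓ α)) y)
    (hc : ∀ α, ContinuousOn (u' α) (Icc (0:ℝ) (N.ℓ α)))
    (hvert : ∀ i : I, ∀ α ∈ N.edges i, ∀ β ∈ N.edges i, N.vval u i α = N.vval u i β)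
    (β : A) (y₀ : ℝ) (hy₀ : y₀ ∈ Icc (0:ℝ) (N.ℓ β)) (hzero : u β y₀ = 0) :
    ∀ α : A, ∀ y ∈ Icc (0:ℝ) (N.ℓ α),
      |u α y| ≤ ∑ α' : A, ∫ z in (0:ℝ)..(N.ℓ α'), |u' α' z| := by
  intro α y hy
  have hnonneg : ∀ α', 0 ≤ ∫ z in (0:ℝ)..(N.ℓ α'), |u' α' z| := fun α' =>
    intervalIntegral.integral_nonneg (N.ℓ_pos α').le fun _ _ => abs_nonneg _
  have hconn := N.isPreconnected_iUnion_image
    (fun α' z hz => (hd α' z hz).continuousWithinAt) hvert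
  have hsub : uIcc 0 (u α y) ⊆ ⋃ α', u α' '' Icc 0 (N.ℓ α') :=
    hconn.ordConnected.uIcc_subset (mem_iUnion_of_mem β ⟨y₀, hy₀, hzero⟩)
      (mem_iUnion_of_mem α ⟨y, hy, rfl⟩)
  rw [← ENNReal.ofReal_le_ofReal_iff (Finset.sum_nonneg fun α' _ => hnonneg α')]
  calc ENNReal.ofReal |u α y| = MeasureTheory.volume (uIcc 0 (u α y)) := by
        rw [Real.volume_interval, sub_zero]
    _ ≤ ∑ α', MeasureTheory.volume (u α' '' Icc 0 (N.ℓ α')) :=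
        (MeasureTheory.measure_mono hsub).trans (MeasureTheory.measure_iUnion_fintype_le _ _)
    _ ≤ ∑ α', ENNReal.ofReal (∫ z in (0:ℝ)..(N.ℓ α'), |u' α' z|) :=
        Finset.sum_le_sum fun α' _ =>
          volume_image_Icc_le_integral_abs_deriv (N.ℓ_pos α').le (hd α') (hc α')
    _ = ENNReal.ofReal (∑ α', ∫ z in (0:ℝ)..(N.ℓ α'), |u' α' z|) :=
        (ENNReal.ofReal_sum_of_nonneg fun α' _ => hnonneg α').symm
end
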